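/- There exists a constant c > 0 such that for every prime p > 2, every generator h of F_p^*, and every integer N with 1 ≤ N ≤ p^(1/2), the set {x·(h^y + h^z + h^t + h^v) : x,y,z,t,v ∈ ℤ, 1 ≤ x,y,z,t,v ≤ N} ⊆ F_p (where the integer x is interpreted as its residue in F_p) has cardinality at least c·N^2. -/

import Mathlib

open Finset


set_option maxHeartbeats 2000000 in
/-- Combinatorial Balog-Szemeredi-Gowers, with a given set of differences. -/
theorem bsg_aux {α : Type*} [AddCommGroup α] [DecidableEq α] (A D : Finset α) (κ : ℝ)
    (hκ : 0 < κ) (hA : A.Nonempty)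
    (hE : κ * (A.card : ℝ) ^ 2 ≤ (((A ×ˢ A).filter (fun x => x.1 - x.2 ∈ D)).card : ℝ)) :
    ∃ B ⊆ A, κ / 4 * (A.card : ℝ) ≤ B.card ∧
      ((((B ×ˢ B).image (fun x => x.1 - x.2)).card : ℝ)) * (κ ^ 5 / 4096 * (A.card : ℝ) ^ 3)
        ≤ (D.card : ℝ) ^ 4 := by
  classical
  set n : ℝ := (A.card : ℝ) with hn
  have hnpos : 0 < n := by rw [hn]; exact_mod_cast hA.card_pos
  let Nb : α → Finset α := fun v => A.filter (fun a => a - v ∈ D)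
  let cn : α → α → Finset α := fun a b => A.filter (fun v => a - v ∈ D ∧ b - v ∈ D)
  set lam : ℝ := κ ^ 2 / 32 with hlam
  have hlampos : 0 < lam := by positivity
  let badP : α × α → Prop := fun x => ((cn x.1 x.2).card : ℝ) < lam * n
  let bad : α → Finset (α × α) := fun v => (Nb v ×ˢ Nb v).filter badP
  -- sum of neighbourhoods
  have h1 : ∑ v ∈ A, ((Nb v).card : ℝ) = (((A ×ˢ A).filter (fun x => x.1 - x.2 ∈ D)).card : ℝ) := by
    rw [card_filter, sum_product_right]
    push_cast
    refine sum_congr rfl fun v _ => ?_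
    simp [Nb]
  have h2 : (κ * n ^ 2) ^ 2 ≤ n * ∑ v ∈ A, ((Nb v).card : ℝ) ^ 2 := by
    calc (κ * n ^ 2) ^ 2 ≤ (∑ v ∈ A, ((Nb v).card : ℝ)) ^ 2 := by
          rw [h1]; gcongr
      _ ≤ _ := sq_sum_le_card_mul_sum_sq
  have h2' : κ ^ 2 * n ^ 3 ≤ ∑ v ∈ A, ((Nb v).card : ℝ) ^ 2 := by
    have : n * (κ ^ 2 * n ^ 3) ≤ n * ∑ v ∈ A, ((Nb v).card : ℝ) ^ 2 := by nlinarith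
    exact le_of_mul_le_mul_left this hnpos
  have h3 : ∑ v ∈ A, ((bad v).card : ℝ) ≤ lam * n * n ^ 2 := by
    have e : ∀ v ∈ A, ((bad v).card : ℝ) = ∑ x ∈ (A ×ˢ A).filter badP,
        if (x.1 - v ∈ D ∧ x.2 - v ∈ D) then (1 : ℝ) else 0 := by
      intro v hv
      rw [← sum_filter, sum_const, nsmul_eq_mul, mul_one]
      congr 2
      ext x
      simp only [bad, Nb, mem_filter, mem_product]
      tauto
    rw [sum_congr rfl e, sum_comm]
    calc _ ≤ ∑ x ∈ (A ×ˢ A).filter badP, lam * n := by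
          refine sum_le_sum fun x hx => ?_
          rw [mem_filter] at hx
          rw [← sum_filter, sum_const, nsmul_eq_mul, mul_one]
          exact hx.2.le
      _ ≤ ∑ x ∈ (A ×ˢ A), lam * n := by
          refine sum_le_sum_of_subset_of_nonneg (filter_subset _ _) fun _ _ _ => by positivity
      _ = _ := by
          rw [sum_const, card_product, nsmul_eq_mul]; push_cast; ring
  obtain ⟨v, hv, hv2⟩ : ∃ v ∈ A, κ ^ 2 * n ^ 2 / 2 ≤ ((Nb v).card : ℝ) ^ 2 - 16 * (bad v).card := by
    apply exists_le_of_sum_le hA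
    rw [sum_const, nsmul_eq_mul, sum_sub_distrib, ← mul_sum]
    have : n * (κ ^ 2 * n ^ 2 / 2) = κ ^ 2 * n ^ 3 - 16 * (lam * n * n ^ 2) := by rw [hlam]; ring
    rw [← hn, this]
    linarith
  set A' := Nb v with hA'
  set m : ℝ := (A'.card : ℝ) with hm
  have hm0 : 0 ≤ m := by positivity
  have hbad0 : (0 : ℝ) ≤ (bad v).card := by positivity
  have hm1 : κ * n / 2 ≤ m := by
    have : (κ * n / 2) ^ 2 ≤ m ^ 2 := by nlinarith [sq_nonneg (κ * n)]
    exact le_of_sq_le_sq this hm0 |> fun h => h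
  have hmpos : 0 < m := lt_of_lt_of_le (by positivity) hm1
  have hbad : ((bad v).card : ℝ) ≤ m ^ 2 / 16 := by nlinarith [sq_nonneg (κ * n)]
  let bp : α → Finset α := fun a => A'.filter (fun c => badP (a, c))
  let A'' := A'.filter (fun a => ((bp a).card : ℝ) ≤ m / 4)
  have hsum : ∑ a ∈ A', ((bp a).card : ℝ) = (bad v).card := by
    simp only [bad, bp, ← hA']
    rw [card_filter _ (A' ×ˢ A'), sum_product]
    push_cast
    refine sum_congr rfl fun v _ => ?_
    simp
    rfl
  have hcA'' : m / 2 ≤ A''.card := by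
    have hx : ((A'.filter (fun a => ¬ ((bp a).card : ℝ) ≤ m / 4)).card : ℝ) * (m / 4) ≤ m ^ 2 / 16 := by
      rw [← nsmul_eq_mul, ← sum_const]
      calc _ ≤ ∑ a ∈ A'.filter (fun a => ¬ ((bp a).card : ℝ) ≤ m / 4), ((bp a).card : ℝ) := by
            refine sum_le_sum fun a ha => ?_
            rw [mem_filter] at ha
            exact (not_le.1 ha.2).le
        _ ≤ ∑ a ∈ A', ((bp a).card : ℝ) :=
            sum_le_sum_of_subset_of_nonneg (filter_subset _ _) fun _ _ _ => by positivity
        _ ≤ _ := by rw [hsum]; exact hbad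
    have hy : (A''.card : ℝ) + (A'.filter (fun a => ¬ ((bp a).card : ℝ) ≤ m / 4)).card = m := by
      rw [hm]; exact_mod_cast card_filter_add_card_filter_not (s := A') (fun a => ((bp a).card : ℝ) ≤ m / 4)
    have : ((A'.filter (fun a => ¬ ((bp a).card : ℝ) ≤ m / 4)).card : ℝ) ≤ m / 4 := by
      have : ((A'.filter (fun a => ¬ ((bp a).card : ℝ) ≤ m / 4)).card : ℝ) * (m / 4) ≤ m / 4 * (m / 4) := by
        nlinarith
      exact le_of_mul_le_mul_right this (by positivity)
    linarith
  refine ⟨A'', (filter_subset _ _).trans (filter_subset _ _), ?_, ?_⟩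
  · linarith
  have hbadsymm : ∀ a b, badP (a, b) → badP (b, a) := by
    intro a b hab
    simp only [badP, cn] at hab ⊢
    simpa only [and_comm] using hab
  -- representation count
  let Q := (D ×ˢ D) ×ˢ (D ×ˢ D)
  let f : (α × α) × (α × α) → α := fun q => q.1.1 - q.1.2 + (q.2.1 - q.2.2)
  have hrep : ∀ d ∈ (A'' ×ˢ A'').image (fun x => x.1 - x.2),
      κ ^ 5 / 4096 * n ^ 3 ≤ ((Q.filter (fun q => f q = d)).card : ℝ) := by
    intro d hd
    simp only [mem_image, mem_product, Prod.exists] at hd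
    obtain ⟨a, b, ⟨ha, hb⟩, rfl⟩ := hd
    let Gd := A'.filter (fun c => ¬ badP (a, c) ∧ ¬ badP (b, c))
    have hGd : m / 2 ≤ Gd.card := by
      have hsub : A' ⊆ Gd ∪ (bp a ∪ bp b) := by
        intro c hc
        simp only [Gd, bp, mem_union, mem_filter, hc, true_and]
        tauto
      have h5 := (card_le_card hsub).trans ((card_union_le _ _).trans
        (Nat.add_le_add_left (card_union_le _ _) _))
      have h6 : m ≤ Gd.card + ((bp a).card + (bp b).card) := by rw [hm]; exact_mod_cast h5
      have ha' := (mem_filter.1 ha).2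
      have hb' := (mem_filter.1 hb).2
      linarith
    let T := Gd.sigma (fun c => cn a c ×ˢ cn b c)
    have hT : m / 2 * (lam * n) ^ 2 ≤ T.card := by
      rw [card_sigma]
      push_cast
      calc m / 2 * (lam * n) ^ 2 ≤ Gd.card * (lam * n) ^ 2 := by gcongr
        _ = ∑ c ∈ Gd, (lam * n) ^ 2 := by rw [sum_const, nsmul_eq_mul]
        _ ≤ _ := by
          refine sum_le_sum fun c hc => ?_
          simp only [Gd, mem_filter, badP, not_lt] at hc
          rw [card_product]; push_cast
          rw [sq]
          exact mul_le_mul hc.2.1 hc.2.2 (by positivity) (by positivity)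
    have hTQ : T.card ≤ (Q.filter (fun q => f q = a - b)).card := by
      refine card_le_card_of_injOn (fun t => ((a - t.2.1, t.1 - t.2.1), (t.1 - t.2.2, b - t.2.2))) ?_ ?_
      · rintro ⟨c, x, y⟩ ht
        simp only [T, coe_sigma, Set.mem_sigma_iff, mem_coe, mem_product, cn, mem_filter] at ht
        simp only [Q, f, mem_coe, mem_filter, mem_product]
        refine ⟨⟨⟨ht.2.1.2.1, ht.2.1.2.2⟩, ht.2.2.2.2, ht.2.2.2.1⟩, by abel⟩
      · rintro ⟨c, x, y⟩ _ ⟨c', x', y'⟩ _ hh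
        simp only [Prod.mk.injEq, sub_right_inj] at hh
        obtain ⟨⟨rfl, h7⟩, h8, rfl⟩ := hh
        have : c = c' := sub_left_injective h7
        subst this; rfl
    calc κ ^ 5 / 4096 * n ^ 3 = (κ * n / 2) / 2 * (lam * n) ^ 2 := by rw [hlam]; ring
      _ ≤ m / 2 * (lam * n) ^ 2 := by gcongr
      _ ≤ T.card := hT
      _ ≤ _ := by exact_mod_cast hTQ
  calc _ = ∑ d ∈ (A'' ×ˢ A'').image (fun x => x.1 - x.2), κ ^ 5 / 4096 * n ^ 3 := by
        rw [sum_const, nsmul_eq_mul]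
    _ ≤ ∑ d ∈ (A'' ×ˢ A'').image (fun x => x.1 - x.2), ((Q.filter (fun q => f q = d)).card : ℝ) :=
        sum_le_sum hrep
    _ ≤ (Q.card : ℝ) := by
        have := card_biUnion (s := (A'' ×ˢ A'').image (fun x => x.1 - x.2))
          (t := fun d => Q.filter (fun q => f q = d)) (by
            intro x _ y _ hxy
            rw [Function.onFun, disjoint_left]
            intro q hq hq'
            exact hxy ((mem_filter.1 hq).2.symm.trans (mem_filter.1 hq').2))
        have h9 : ((A'' ×ˢ A'').image (fun x => x.1 - x.2)).biUnion
            (fun d => Q.filter (fun q => f q = d)) ⊆ Q := by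
          intro q hq
          simp only [mem_biUnion] at hq
          obtain ⟨d, _, hq⟩ := hq
          exact (mem_filter.1 hq).1
        have h10 := card_le_card h9
        rw [this] at h10
        exact_mod_cast h10
    _ = _ := by simp only [Q, card_product]; push_cast; ring


section covering
open scoped Pointwise

/-- `x B` is covered by at most `t` translates of `m (B - B)`. -/
def CovP {F : Type*} [Field F] [DecidableEq F] (B : Finset F) (x : F) (t : ℝ) (m : ℕ) : Prop :=
  ∃ T : Finset F, (T.card : ℝ) ≤ t ∧ ∀ b ∈ B, ∃ τ ∈ T, ∃ z ∈ m • (B - B), x * b = τ + z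

theorem neg_mem_nsmul_sub {F : Type*} [Field F] [DecidableEq F] (B : Finset F) (m : ℕ) (z : F)
    (hz : z ∈ m • (B - B)) : -z ∈ m • (B - B) := by
  have : -(m • (B - B)) = m • (B - B) := by
    rw [nsmul_sub, neg_sub]
  rw [← this]
  simpa using hz

theorem CovP.neg {F : Type*} [Field F] [DecidableEq F] {B : Finset F} {x : F} {t : ℝ} {m : ℕ}
    (h : CovP B x t m) : CovP B (-x) t m := by
  obtain ⟨T, hT, h⟩ := h
  refine ⟨-T, by rwa [card_neg], fun b hb => ?_⟩
  obtain ⟨τ, hτ, z, hz, e⟩ := h b hb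
  exact ⟨-τ, by simpa using hτ, -z, neg_mem_nsmul_sub _ _ _ hz, by rw [neg_mul, e]; ring⟩

theorem CovP.add {F : Type*} [Field F] [DecidableEq F] {B : Finset F} {x x' : F} {t t' : ℝ}
    {m m' : ℕ} (h : CovP B x t m) (h' : CovP B x' t' m') : CovP B (x + x') (t * t') (m + m') := by
  obtain ⟨T, hT, h⟩ := h
  obtain ⟨T', hT', h'⟩ := h'
  refine ⟨T + T', ?_, fun b hb => ?_⟩
  · calc ((T + T').card : ℝ) ≤ T.card * T'.card := by exact_mod_cast card_add_le
      _ ≤ t * t' := mul_le_mul hT hT' (by positivity) (le_trans (by positivity) hT)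
  obtain ⟨τ, hτ, z, hz, e⟩ := h b hb
  obtain ⟨τ', hτ', z', hz', e'⟩ := h' b hb
  exact ⟨τ + τ', add_mem_add hτ hτ', z + z', by rw [add_nsmul]; exact add_mem_add hz hz',
    by rw [add_mul, e, e']; ring⟩

theorem CovP.sub {F : Type*} [Field F] [DecidableEq F] {B : Finset F} {x x' : F} {t t' : ℝ}
    {m m' : ℕ} (h : CovP B x t m) (h' : CovP B x' t' m') : CovP B (x - x') (t * t') (m + m') := by
  rw [sub_eq_add_neg]; exact h.add h'.neg

theorem CovP.mul {F : Type*} [Field F] [DecidableEq F] {B : Finset F} {x x' : F} {t t' : ℝ}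
    (h : CovP B x t 1) (h' : CovP B x' t' 1) : CovP B (x * x') (t' * (t * t)) 2 := by
  obtain ⟨T, hT, h⟩ := h
  obtain ⟨T', hT', h'⟩ := h'
  refine ⟨T'.image (x * ·) + (T - T), ?_, fun b hb => ?_⟩
  · calc ((T'.image (x * ·) + (T - T)).card : ℝ) ≤ T'.card * (T.card * T.card) := by
          norm_cast
          exact card_add_le.trans (Nat.mul_le_mul card_image_le card_sub_le)
      _ ≤ _ := by
        have : (0 : ℝ) ≤ t := le_trans (by positivity) hT
        have : (0 : ℝ) ≤ t' := le_trans (by positivity) hT'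
        gcongr
  obtain ⟨τ, hτ, z, hz, e⟩ := h' b hb
  rw [one_nsmul] at hz
  obtain ⟨b1, hb1, b2, hb2, rfl⟩ := mem_sub.1 hz
  obtain ⟨τ1, hτ1, z1, hz1, e1⟩ := h b1 hb1
  obtain ⟨τ2, hτ2, z2, hz2, e2⟩ := h b2 hb2
  refine ⟨x * τ + (τ1 - τ2), add_mem_add (mem_image_of_mem _ hτ) (sub_mem_sub hτ1 hτ2), z1 + -z2, ?_, ?_⟩
  · rw [show (2 : ℕ) = 1 + 1 from rfl, add_nsmul]
    exact add_mem_add hz1 (neg_mem_nsmul_sub _ _ _ hz2)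
  · rw [mul_assoc, e]
    linear_combination e1 - e2

theorem plu_real {F : Type*} [Field F] [DecidableEq F] {B : Finset F} (hB : B.Nonempty) {L : ℝ}
    (hL : ((B - B).card : ℝ) ≤ L * B.card) (m n : ℕ) :
    ((m • B - n • B).card : ℝ) ≤ L ^ (m + n) * B.card := by
  have h := pluennecke_ruzsa_inequality_nsmul_sub_nsmul_sub hB B m n
  have h' : ((m • B - n • B).card : ℝ) ≤ (((B - B).card : ℝ) / B.card) ^ (m + n) * B.card := by
    have h3 := (NNRat.cast_le (K := ℝ)).2 h
    push_cast at h3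
    exact h3
  have hpos : (0 : ℝ) < B.card := by exact_mod_cast hB.card_pos
  refine h'.trans ?_
  gcongr
  rwa [div_le_iff₀ hpos]

theorem covP_of_inter {F : Type*} [Field F] [DecidableEq F] {B : Finset F} (hB : B.Nonempty) {L : ℝ}
    (hL1 : 1 ≤ L)
    (hL : ((B - B).card : ℝ) ≤ L * B.card) (y : F)
    (hy : (B.card : ℝ) ≤ L * (B ∩ B.image (y * ·)).card) : CovP B y (L ^ 3) 1 := by
  set yB := B.image (y * ·) with hyB
  set I := B ∩ yB with hI
  have hpos : (0 : ℝ) < B.card := by exact_mod_cast hB.card_pos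
  have hIpos : (0 : ℝ) < I.card := by
    by_contra hc
    have : (I.card : ℝ) = 0 := le_antisymm (not_lt.1 hc) (by positivity)
    rw [this] at hy; linarith
  have htri : ((yB - B).card : ℝ) * I.card ≤ (yB - I).card * (B - I).card := by
    exact_mod_cast ruzsa_triangle_inequality_sub_sub_sub yB I B
  have e1 : ((yB - I).card : ℝ) ≤ L * B.card := by
    refine le_trans ?_ hL
    have h1 : yB - I ⊆ (B - B).image (y * ·) := by
      refine (sub_subset_sub_left inter_subset_right).trans ?_
      intro z hz
      obtain ⟨a, ha, b, hb, rfl⟩ := mem_sub.1 hz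
      obtain ⟨a', ha', rfl⟩ := mem_image.1 ha
      obtain ⟨b', hb', rfl⟩ := mem_image.1 hb
      exact mem_image.2 ⟨a' - b', sub_mem_sub ha' hb', by ring⟩
    exact_mod_cast (card_le_card h1).trans card_image_le
  have e2 : ((B - I).card : ℝ) ≤ L * B.card := by
    refine le_trans ?_ hL
    exact_mod_cast card_le_card (sub_subset_sub_left inter_subset_left)
  have e3 : ((yB + -B).card : ℝ) ≤ L ^ 3 * (-B).card := by
    rw [card_neg, ← sub_eq_add_neg]
    have : ((yB - B).card : ℝ) * I.card ≤ (L ^ 3 * B.card) * I.card := by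
      calc _ ≤ (L * B.card) * (L * B.card) := htri.trans (by gcongr)
        _ ≤ (L * B.card) * (L * (L * I.card)) := by gcongr
        _ = _ := by ring
    exact le_of_mul_le_mul_right this hIpos
  obtain ⟨T, hT, hT2, hT3⟩ := ruzsa_covering_add hB.neg e3
  refine ⟨T, hT2, fun b hb => ?_⟩
  have h4 := hT3 (mem_image_of_mem _ hb)
  obtain ⟨τ, hτ, z, hz, e⟩ := mem_add.1 h4
  refine ⟨τ, hτ, z, ?_, e.symm⟩
  rw [one_nsmul]
  have : -B - -B = B - B := by rw [neg_sub_neg]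
  rwa [this] at hz

theorem CovP.card_add {F : Type*} [Field F] [DecidableEq F] {B : Finset F} (hB : B.Nonempty) {L : ℝ}
    (hL : ((B - B).card : ℝ) ≤ L * B.card) {x : F} {t : ℝ} {m : ℕ} (h : CovP B x t m) :
    (((B ×ˢ B).image (fun q => q.1 + x * q.2)).card : ℝ) ≤ t * L ^ (2 * m + 1) * B.card := by
  obtain ⟨T, hT, h⟩ := h
  have hsub : (B ×ˢ B).image (fun q => q.1 + x * q.2) ⊆ T + ((m + 1) • B - m • B) := by
    intro w hw
    obtain ⟨q, hq, rfl⟩ := mem_image.1 hw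
    obtain ⟨h1, h2⟩ := mem_product.1 hq
    obtain ⟨τ, hτ, z, hz, e⟩ := h _ h2
    refine mem_add.2 ⟨τ, hτ, q.1 + z, ?_, by rw [e]; ring⟩
    rw [nsmul_sub] at hz
    rw [succ_nsmul', add_sub_assoc]
    exact add_mem_add h1 hz
  calc _ ≤ ((T + ((m + 1) • B - m • B)).card : ℝ) := by exact_mod_cast card_le_card hsub
    _ ≤ T.card * ((m + 1) • B - m • B).card := by exact_mod_cast card_add_le
    _ ≤ t * (L ^ (m + 1 + m) * B.card) := by
        have := plu_real hB hL (m + 1) m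
        exact mul_le_mul hT this (by positivity) (le_trans (by positivity) hT)
    _ = _ := by rw [show m + 1 + m = 2 * m + 1 by ring]; ring
end covering

/-- number of quadruples -/
def enq {F : Type*} [Field F] [DecidableEq F] (B : Finset F) (y : F) : ℕ :=
  (((B ×ˢ B) ×ˢ (B ×ˢ B)).filter
    (fun q => q.1.1 + y * q.1.2 = q.2.1 + y * q.2.2)).card

theorem cs_fiber {α β : Type*} [DecidableEq β] (s : Finset α) (f : α → β) :
    (s.card : ℝ) ^ 2 ≤ (s.image f).card * ((s ×ˢ s).filter (fun q => f q.1 = f q.2)).card := by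
  classical
  have h1 : (s.card : ℝ) = ∑ b ∈ s.image f, ((s.filter (fun a => f a = b)).card : ℝ) := by
    exact_mod_cast card_eq_sum_card_image f s
  have h2 : (((s ×ˢ s).filter (fun q => f q.1 = f q.2)).card : ℝ) =
      ∑ b ∈ s.image f, ((s.filter (fun a => f a = b)).card : ℝ) ^ 2 := by
    rw [card_eq_sum_card_fiberwise (f := fun q => f q.1) (t := s.image f)]
    · push_cast
      refine sum_congr rfl fun b _ => ?_
      rw [sq]
      norm_cast
      rw [← card_product]
      congr 1
      ext q
      simp only [mem_filter, mem_product]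
      constructor
      · rintro ⟨⟨⟨a, b⟩, c⟩, d⟩; exact ⟨⟨a, d⟩, b, c ▸ d⟩
      · rintro ⟨⟨a, b⟩, c, d⟩; exact ⟨⟨⟨a, c⟩, b.trans d.symm⟩, b⟩
    · intro q hq
      rw [mem_coe, mem_filter, mem_product] at hq
      exact mem_coe.2 (mem_image_of_mem _ hq.1.1)
  rw [h1, h2]
  exact sq_sum_le_card_mul_sum_sq

theorem enq_cs {F : Type*} [Field F] [DecidableEq F] (B : Finset F) (y : F) :
    (B.card : ℝ) ^ 4 ≤ (((B ×ˢ B).image (fun q => q.1 + y * q.2)).card : ℝ) * enq B y := by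
  have := cs_fiber (B ×ˢ B) (fun q => q.1 + y * q.2)
  rw [card_product] at this
  push_cast at this
  calc _ = ((B.card : ℝ) * B.card) ^ 2 := by ring
    _ ≤ _ := this

theorem enq_sum {F : Type*} [Field F] [Fintype F] [DecidableEq F] (B : Finset F) :
    (∑ y : F, (enq B y : ℝ)) ≤ Fintype.card F * (B.card : ℝ) ^ 2 + (B.card : ℝ) ^ 4 := by
  have h : (∑ y : F, enq B y) ≤ ∑ q ∈ (B ×ˢ B) ×ˢ (B ×ˢ B),
      ((if q.1 = q.2 then Fintype.card F else 0) + 1) := by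
    simp only [enq, card_filter]
    rw [sum_comm]
    refine sum_le_sum fun q _ => ?_
    rw [← card_filter]
    split_ifs with hq
    · exact (card_le_univ _).trans (Nat.le_succ _)
    · rw [zero_add, card_le_one]
      intro y hy y' hy'
      simp only [mem_filter, mem_univ, true_and] at hy hy'
      have hne : q.1.2 - q.2.2 ≠ 0 := by
        intro h0
        have h1 : q.1.2 = q.2.2 := sub_eq_zero.1 h0
        rw [h1] at hy
        exact hq (Prod.ext (add_right_cancel hy) h1)
      have : (y - y') * (q.1.2 - q.2.2) = 0 := by linear_combination hy - hy'
      rcases mul_eq_zero.1 this with h | h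
      · exact sub_eq_zero.1 h
      · exact absurd h hne
  have h2 : ∑ q ∈ (B ×ˢ B) ×ˢ (B ×ˢ B), ((if q.1 = q.2 then Fintype.card F else 0) + 1)
      = Fintype.card F * B.card ^ 2 + B.card ^ 4 := by
    rw [sum_add_distrib, sum_const, sum_product]
    simp only [sum_ite_eq, card_product, smul_eq_mul, mul_one]
    have : ∀ x ∈ B ×ˢ B, (if x ∈ B ×ˢ B then Fintype.card F else 0) = Fintype.card F := by
      intro x hx; rw [if_pos hx]
    rw [sum_congr rfl this, sum_const, card_product, smul_eq_mul]
    ring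
  rw [h2] at h
  exact_mod_cast h

theorem enq_sum_subset {F : Type*} [Field F] [Fintype F] [DecidableEq F] (B Y : Finset F) :
    (∑ y ∈ Y, (enq B y : ℝ)) ≤
      Fintype.card F * (B.card : ℝ) ^ 2 + Y.card * ((B.card : ℝ) ^ 4 / Fintype.card F) := by
  have hp : (0 : ℝ) < Fintype.card F := by exact_mod_cast Fintype.card_pos
  have hnn : ∀ y : F, 0 ≤ (enq B y : ℝ) - (B.card : ℝ) ^ 4 / Fintype.card F := by
    intro y
    rw [sub_nonneg, div_le_iff₀' hp]
    refine (enq_cs B y).trans ?_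
    gcongr
    exact_mod_cast card_le_univ _
  have h1 : ∑ y ∈ Y, ((enq B y : ℝ) - (B.card : ℝ) ^ 4 / Fintype.card F) ≤
      ∑ y : F, ((enq B y : ℝ) - (B.card : ℝ) ^ 4 / Fintype.card F) :=
    sum_le_sum_of_subset_of_nonneg (subset_univ _) fun y _ _ => hnn y
  have h2 := enq_sum B
  rw [sum_sub_distrib, sum_sub_distrib, sum_const, sum_const, nsmul_eq_mul, nsmul_eq_mul,
    card_univ, mul_div_cancel₀ _ hp.ne'] at h1
  linarith

theorem pivot {p : ℕ} [Fact p.Prime] (H : Finset (ZMod p)) (h2 : 2 ≤ H.card)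
    (hp : (H.card : ℝ) ^ 2 ≤ p) :
    ∃ g1 ∈ H, ∃ g2 ∈ H, ∃ g3 ∈ H, ∃ g4 ∈ H, ∃ v, (v = g1 - g2 ∨ v = (g1 - g2) + (g3 - g4)) ∧
      (H.card : ℝ) ^ 2 / 2 ≤ ((H ×ˢ H).image (fun q => (g3 - g4) * q.1 + v * q.2)).card := by
  have hH0 : (0 : ℝ) < H.card := by exact_mod_cast (by omega : 0 < H.card)
  have hscale : ∀ u ξ : ZMod p, u ≠ 0 →
      ((H ×ˢ H).image (fun q => u * q.1 + (u * ξ) * q.2)).card =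
        ((H ×ˢ H).image (fun q => q.1 + ξ * q.2)).card := by
    intro u ξ hu
    rw [← card_image_of_injective ((H ×ˢ H).image (fun q => q.1 + ξ * q.2)) (mul_right_injective₀ hu),
      image_image]
    congr 2
    ext q
    simp only [Function.comp]
    ring
  obtain ⟨ga, hga, gb, hgb, hab⟩ := one_lt_card.1 h2
  let R : ZMod p → Prop := fun ξ => ∃ g1 ∈ H, ∃ g2 ∈ H, ∃ g3 ∈ H, ∃ g4 ∈ H, g3 ≠ g4 ∧
    (g3 - g4) * ξ = g1 - g2
  by_cases hR : ∀ ξ, R ξ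
  · have hsum := enq_sum H
    rw [ZMod.card] at hsum
    obtain ⟨ξ, -, hξ⟩ : ∃ ξ ∈ (univ : Finset (ZMod p)), (enq H ξ : ℝ) ≤ 2 * (H.card : ℝ) ^ 2 := by
      apply exists_le_of_sum_le univ_nonempty
      rw [sum_const, card_univ, ZMod.card, nsmul_eq_mul]
      nlinarith [sq_nonneg (H.card : ℝ)]
    obtain ⟨g1, h1, g2, h2, g3, h3, g4, h4, hne, e⟩ := hR ξ
    refine ⟨g1, h1, g2, h2, g3, h3, g4, h4, g1 - g2, Or.inl rfl, ?_⟩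
    rw [← e, hscale _ _ (sub_ne_zero.2 hne)]
    have hcs := enq_cs H ξ
    have : (H.card : ℝ) ^ 2 / 2 * (2 * (H.card : ℝ) ^ 2) ≤
      (((H ×ˢ H).image (fun q => q.1 + ξ * q.2)).card : ℝ) * (2 * (H.card : ℝ) ^ 2) := by
      calc _ = (H.card : ℝ) ^ 4 := by ring
        _ ≤ _ := hcs.trans (by gcongr)
    exact le_of_mul_le_mul_right this (by positivity)
  · obtain ⟨ξ, hξ, hξ1⟩ : ∃ ξ, R ξ ∧ ¬ R (ξ + 1) := by
      by_contra hc
      push Not at hc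
      apply hR
      have hnat : ∀ n : ℕ, R (n : ZMod p) := by
        intro n
        induction n with
        | zero => exact ⟨ga, hga, ga, hga, ga, hga, gb, hgb, hab, by simp⟩
        | succ n ih => push_cast; exact hc _ ih
      intro ξ
      have := hnat ξ.val
      rwa [ZMod.natCast_zmod_val] at this
    obtain ⟨g1, h1, g2, h2, g3, h3, g4, h4, hne, e⟩ := hξ
    refine ⟨g1, h1, g2, h2, g3, h3, g4, h4, _, Or.inr rfl, ?_⟩
    have e' : (g1 - g2) + (g3 - g4) = (g3 - g4) * (ξ + 1) := by rw [← e]; ring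
    rw [e', hscale _ _ (sub_ne_zero.2 hne), card_image_of_injOn]
    · rw [card_product]; push_cast; nlinarith [sq_nonneg (H.card : ℝ)]
    · rintro ⟨a, b⟩ hq ⟨a', b'⟩ hq' hh
      simp only [coe_product, Set.mem_prod, mem_coe] at hq hq'
      simp only at hh
      by_cases hb : b = b'
      · subst hb; rw [add_right_cancel hh]
      · exact absurd ⟨a', hq'.1, a, hq.1, b, hq.2, b', hq'.2, hb, by linear_combination hh⟩ hξ1

open scoped Pointwise in
theorem alg_core {p : ℕ} [Fact p.Prime] (B H : Finset (ZMod p)) (L : ℝ) (hL1 : 1 ≤ L)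
    (hB : B.Nonempty) (hL : ((B - B).card : ℝ) ≤ L * B.card)
    (hH : ∀ y ∈ H, (B.card : ℝ) ≤ L * (B ∩ B.image (y * ·)).card) (h2 : 2 ≤ H.card)
    (hp : (H.card : ℝ) ^ 2 ≤ p) (hBp : 2 * L ^ 79 * B.card ≤ p) :
    (H.card : ℝ) ^ 2 * B.card ≤ 4 * L ^ 79 * p := by
  have hpp : (0 : ℝ) < p := by exact_mod_cast (Fact.out : p.Prime).pos
  have hBpos : (0 : ℝ) < B.card := by exact_mod_cast hB.card_pos
  obtain ⟨g1, h1, g2, h2, g3, h3, g4, h4, v, hv, hY⟩ := pivot H h2 hp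
  set Y := (H ×ˢ H).image (fun q => (g3 - g4) * q.1 + v * q.2) with hYdef
  have c1 : ∀ y ∈ H, CovP B y (L ^ 3) 1 := fun y hy => covP_of_inter hB hL1 hL y (hH y hy)
  have c2 : ∀ y ∈ H, ∀ y' ∈ H, CovP B (y * y') (L ^ 9) 2 := by
    intro y hy y' hy'
    have := (c1 y hy).mul (c1 y' hy')
    convert this using 1; ring
  have hLpos : 0 < L := by linarith
  set W := L ^ 79 with hW
  have hWpos : 0 < W := by positivity
  have cY : ∀ y ∈ Y, (((B ×ˢ B).image (fun q => q.1 + y * q.2)).card : ℝ) ≤ W * B.card := by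
    intro y hy
    obtain ⟨⟨a, b⟩, hq, rfl⟩ := mem_image.1 hy
    obtain ⟨ha, hb⟩ := mem_product.1 hq
    simp only at ha hb ⊢
    rcases hv with rfl | rfl
    · have := ((c2 g3 h3 a ha).sub (c2 g4 h4 a ha)).add ((c2 g1 h1 b hb).sub (c2 g2 h2 b hb))
      have h5 := CovP.card_add hB hL this
      rw [show (g3 - g4) * a + (g1 - g2) * b = (g3 * a - g4 * a) + (g1 * b - g2 * b) by ring]
      refine h5.trans ?_
      gcongr
      calc _ = L ^ 53 := by ring
        _ ≤ L ^ 79 := pow_le_pow_right₀ hL1 (by norm_num)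
    · have := ((c2 g3 h3 a ha).sub (c2 g4 h4 a ha)).add
        (((c2 g1 h1 b hb).sub (c2 g2 h2 b hb)).add ((c2 g3 h3 b hb).sub (c2 g4 h4 b hb)))
      have h5 := CovP.card_add hB hL this
      rw [show (g3 - g4) * a + ((g1 - g2) + (g3 - g4)) * b =
        (g3 * a - g4 * a) + ((g1 * b - g2 * b) + (g3 * b - g4 * b)) by ring]
      refine h5.trans ?_
      gcongr
      apply le_of_eq
      ring
  have hE : ∀ y ∈ Y, (B.card : ℝ) ^ 3 / W ≤ enq B y := by
    intro y hy
    rw [div_le_iff₀ hWpos]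
    have h6 := (enq_cs B y).trans (mul_le_mul_of_nonneg_right (cY y hy) (by positivity))
    have : (B.card : ℝ) * (B.card : ℝ) ^ 3 ≤ B.card * (enq B y * W) := by
      calc _ = (B.card : ℝ) ^ 4 := by ring
        _ ≤ _ := h6
        _ = _ := by ring
    exact le_of_mul_le_mul_left this hBpos
  have hs := enq_sum_subset B Y
  rw [ZMod.card] at hs
  have hs2 : (Y.card : ℝ) * ((B.card : ℝ) ^ 3 / W) ≤ ∑ y ∈ Y, (enq B y : ℝ) := by
    rw [← nsmul_eq_mul, ← sum_const]; exact sum_le_sum hE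
  have hs3 : (B.card : ℝ) ^ 4 / p ≤ (B.card : ℝ) ^ 3 / W / 2 := by
    rw [div_div, div_le_div_iff₀ hpp (by positivity)]
    calc (B.card : ℝ) ^ 4 * (W * 2) = (B.card : ℝ) ^ 3 * (2 * W * B.card) := by ring
      _ ≤ _ := by gcongr
  have hs4 : (Y.card : ℝ) * ((B.card : ℝ) ^ 3 / W) / 2 ≤ p * (B.card : ℝ) ^ 2 := by
    have : (Y.card : ℝ) * ((B.card : ℝ) ^ 4 / p) ≤ Y.card * ((B.card : ℝ) ^ 3 / W / 2) := by gcongr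
    linarith
  have hs5 : (Y.card : ℝ) * B.card ≤ 2 * W * p := by
    have e : (Y.card : ℝ) * ((B.card : ℝ) ^ 3 / W) / 2 = (Y.card * B.card) / (2 * W) * (B.card : ℝ) ^ 2 := by
      field_simp
    rw [e] at hs4
    have := le_of_mul_le_mul_right hs4 (by positivity)
    rw [div_le_iff₀ (by positivity)] at this
    linarith
  nlinarith


section fourier
open ComplexConjugate

/-- additive character -/
noncomputable def ee {p : ℕ} [Fact p.Prime] (x : ZMod p) : ℂ := ZMod.stdAddChar x

theorem ee_add {p : ℕ} [Fact p.Prime] (x y : ZMod p) : ee (x + y) = ee x * ee y :=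
  AddChar.map_add_eq_mul _ _ _

theorem ee_norm {p : ℕ} [Fact p.Prime] (x : ZMod p) : ‖ee x‖ = 1 :=
  AddChar.norm_apply _ _

theorem ee_zero {p : ℕ} [Fact p.Prime] : ee (0 : ZMod p) = 1 := AddChar.map_zero_eq_one _

theorem ee_conj {p : ℕ} [Fact p.Prime] (x : ZMod p) : conj (ee x) = ee (-x) := by
  have h1 : ee x * ee (-x) = 1 := by rw [← ee_add, add_neg_cancel, ee_zero]
  have h2 : ee x * conj (ee x) = 1 := by
    rw [Complex.mul_conj, Complex.normSq_eq_norm_sq, ee_norm]; simp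
  have h0 : ee x ≠ 0 := by intro h; rw [h, zero_mul] at h1; exact zero_ne_one h1
  exact mul_left_cancel₀ h0 (h2.trans h1.symm)

theorem ee_sum {p : ℕ} [Fact p.Prime] (b : ZMod p) :
    ∑ t : ZMod p, ee (t * b) = if b = 0 then (p : ℂ) else 0 := by
  have := AddChar.sum_mulShift (ψ := ZMod.stdAddChar (N := p)) b (ZMod.isPrimitive_stdAddChar p)
  rw [ZMod.card] at this
  unfold ee
  rw [this]
  split_ifs <;> simp

theorem normsq_sum {p : ℕ} [Fact p.Prime] {ι : Type*} (s : Finset ι) (c : ι → ℂ) (f : ι → ZMod p)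
    (t : ZMod p) :
    ((‖∑ i ∈ s, c i * ee (t * f i)‖ ^ 2 : ℝ) : ℂ) =
      ∑ i ∈ s, ∑ j ∈ s, c i * conj (c j) * ee (t * (f i - f j)) := by
  rw [← Complex.normSq_eq_norm_sq, ← Complex.mul_conj, map_sum, sum_mul_sum]
  refine sum_congr rfl fun i _ => sum_congr rfl fun j _ => ?_
  rw [map_mul, ee_conj, mul_sub, sub_eq_add_neg, ee_add]
  ring

theorem orth {p : ℕ} [Fact p.Prime] {ι : Type*} (s : Finset ι) (f : ι → ZMod p) :
    ∑ t : ZMod p, ‖∑ i ∈ s, ee (t * f i)‖ ^ 2 =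
      p * (((s ×ˢ s).filter (fun q => f q.1 = f q.2)).card : ℝ) := by
  have h : ((∑ t : ZMod p, ‖∑ i ∈ s, ee (t * f i)‖ ^ 2 : ℝ) : ℂ) =
      ((p * (((s ×ˢ s).filter (fun q => f q.1 = f q.2)).card : ℝ) : ℝ) : ℂ) := by
    push_cast
    have e : ∀ t : ZMod p, ((‖∑ i ∈ s, ee (t * f i)‖ : ℂ)) ^ 2 =
        ∑ q ∈ s ×ˢ s, ee (t * (f q.1 - f q.2)) := by
      intro t
      have := normsq_sum s (fun _ => 1) f t
      simp only [one_mul, map_one] at this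
      push_cast at this
      rw [this, sum_product]
    rw [sum_congr rfl fun t _ => e t, sum_comm]
    simp only [ee_sum, sub_eq_zero]
    rw [← sum_filter, sum_const, nsmul_eq_mul, mul_comm]
  exact_mod_cast h

/-- exponential sum over powers -/
noncomputable def SS {p : ℕ} [Fact p.Prime] (h : ZMod p) (N : ℕ) (t : ZMod p) : ℂ :=
  ∑ y ∈ Icc 1 N, ee (t * h ^ y)

/-- large spectrum -/
noncomputable def Sp {p : ℕ} [Fact p.Prime] (h : ZMod p) (N : ℕ) (s : ℝ) : Finset (ZMod p) :=
  univ.filter (fun t => s * N ≤ ‖SS h N t‖)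

theorem mem_Sp {p : ℕ} [Fact p.Prime] {h : ZMod p} {N : ℕ} {s : ℝ} {t : ZMod p} :
    t ∈ Sp h N s ↔ s * N ≤ ‖SS h N t‖ := by simp [Sp]

theorem SS_norm_le {p : ℕ} [Fact p.Prime] (h : ZMod p) (N : ℕ) (t : ZMod p) : ‖SS h N t‖ ≤ N := by
  unfold SS
  refine (norm_sum_le _ _).trans ?_
  simp [ee_norm]

theorem SS_parseval {p : ℕ} [Fact p.Prime] (h : ZMod p) (N : ℕ)
    (hinj : Set.InjOn (fun y : ℕ => h ^ y) (Icc 1 N : Finset ℕ)) :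
    ∑ t : ZMod p, ‖SS h N t‖ ^ 2 = p * N := by
  have := orth (Icc 1 N) (fun y => h ^ y)
  unfold SS
  rw [this]
  congr 1
  have : ((Icc 1 N ×ˢ Icc 1 N).filter (fun q : ℕ × ℕ => h ^ q.1 = h ^ q.2)) =
      (Icc 1 N).image (fun y => (y, y)) := by
    ext ⟨a, b⟩
    simp only [mem_filter, mem_product, mem_image, Prod.mk.injEq]
    constructor
    · rintro ⟨⟨ha, hb⟩, e⟩
      exact ⟨a, ha, rfl, hinj (mem_coe.2 ha) (mem_coe.2 hb) e⟩
    · rintro ⟨y, hy, rfl, rfl⟩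
      exact ⟨⟨hy, hy⟩, rfl⟩
  rw [this, card_image_of_injective _ (fun a b hab => (Prod.mk.inj hab).1)]
  simp

theorem Sp_card {p : ℕ} [Fact p.Prime] (h : ZMod p) (N : ℕ) (hN : 1 ≤ N)
    (hinj : Set.InjOn (fun y : ℕ => h ^ y) (Icc 1 N : Finset ℕ)) (s : ℝ) (hs : 0 < s) :
    ((Sp h N s).card : ℝ) * (s ^ 2 * N) ≤ p := by
  have hN0 : (0 : ℝ) < N := by exact_mod_cast hN
  have h1 : ((Sp h N s).card : ℝ) * (s * N) ^ 2 ≤ p * N := by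
    rw [← SS_parseval h N hinj, ← nsmul_eq_mul, ← sum_const]
    calc _ ≤ ∑ t ∈ Sp h N s, ‖SS h N t‖ ^ 2 := by
          refine sum_le_sum fun t ht => ?_
          have := mem_Sp.1 ht
          gcongr
      _ ≤ _ := sum_le_sum_of_subset_of_nonneg (subset_univ _) fun _ _ _ => by positivity
  have : ((Sp h N s).card : ℝ) * (s ^ 2 * N) * N ≤ p * N := by
    calc _ = ((Sp h N s).card : ℝ) * (s * N) ^ 2 := by ring
      _ ≤ _ := h1
  exact le_of_mul_le_mul_right this hN0

theorem Sp_diff {p : ℕ} [Fact p.Prime] (h : ZMod p) (N : ℕ) (hN : 1 ≤ N) (s : ℝ) (hs : 0 < s)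
    (Λ : Finset (ZMod p)) (hΛ : Λ ⊆ Sp h N s) :
    s ^ 2 / 2 * (Λ.card : ℝ) ^ 2 ≤
      ((Λ ×ˢ Λ).filter (fun x => x.1 - x.2 ∈ Sp h N (s ^ 2 / 2))).card := by
  have hN0 : (0 : ℝ) < N := by exact_mod_cast hN
  let c : ZMod p → ℂ := fun t => conj (SS h N t) / ‖SS h N t‖
  have hSpos : ∀ t ∈ Λ, 0 < ‖SS h N t‖ := fun t ht =>
    lt_of_lt_of_le (by positivity) (mem_Sp.1 (hΛ ht))
  have hc : ∀ t ∈ Λ, c t * SS h N t = ‖SS h N t‖ := by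
    intro t ht
    have h0 : (‖SS h N t‖ : ℂ) ≠ 0 := by exact_mod_cast (hSpos t ht).ne'
    simp only [c]
    rw [div_mul_eq_mul_div, mul_comm, Complex.mul_conj, Complex.normSq_eq_norm_sq, div_eq_iff h0]
    push_cast; ring
  have hc1 : ∀ t ∈ Λ, ‖c t‖ = 1 := by
    intro t ht
    have h0 : ‖SS h N t‖ ≠ 0 := (hSpos t ht).ne'
    simp [c, h0]
  have e1 : ((∑ t ∈ Λ, ‖SS h N t‖ : ℝ) : ℂ) = ∑ y ∈ Icc 1 N, ∑ t ∈ Λ, c t * ee (h ^ y * t) := by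
    push_cast
    rw [sum_comm]
    refine sum_congr rfl fun t ht => ?_
    rw [← hc t ht, SS, mul_sum]
    simp only [mul_comm]
  have e2 : (∑ t ∈ Λ, ‖SS h N t‖) ≤ ∑ y ∈ Icc 1 N, ‖∑ t ∈ Λ, c t * ee (h ^ y * t)‖ := by
    have := congrArg norm e1
    rw [Complex.norm_real, Real.norm_of_nonneg (sum_nonneg fun _ _ => norm_nonneg _)] at this
    rw [this]
    exact norm_sum_le _ _
  have e3 : (∑ t ∈ Λ, ‖SS h N t‖) ^ 2 ≤
      N * ∑ y ∈ Icc 1 N, ‖∑ t ∈ Λ, c t * ee (h ^ y * t)‖ ^ 2 := by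
    refine (pow_le_pow_left₀ (sum_nonneg fun _ _ => norm_nonneg _) e2 2).trans ?_
    refine sq_sum_le_card_mul_sum_sq.trans ?_
    simp
  have e4 : ∑ y ∈ Icc 1 N, ‖∑ t ∈ Λ, c t * ee (h ^ y * t)‖ ^ 2 ≤
      ∑ q ∈ Λ ×ˢ Λ, ‖SS h N (q.1 - q.2)‖ := by
    have e5 : ((∑ y ∈ Icc 1 N, ‖∑ t ∈ Λ, c t * ee (h ^ y * t)‖ ^ 2 : ℝ) : ℂ) =
        ∑ q ∈ Λ ×ˢ Λ, c q.1 * conj (c q.2) * SS h N (q.1 - q.2) := by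
      rw [Complex.ofReal_sum]
      rw [sum_congr rfl fun y _ => normsq_sum Λ c (fun t => t) (h ^ y)]
      rw [sum_product, sum_comm]
      refine sum_congr rfl fun t _ => ?_
      rw [sum_comm]
      refine sum_congr rfl fun t' _ => ?_
      rw [SS, mul_sum]
      simp only [mul_comm]
    have := congrArg norm e5
    rw [Complex.norm_real, Real.norm_of_nonneg (sum_nonneg fun _ _ => by positivity)] at this
    rw [this]
    refine (norm_sum_le _ _).trans (sum_le_sum fun q hq => ?_)
    obtain ⟨h1, h2⟩ := mem_product.1 hq
    rw [norm_mul, norm_mul, hc1 _ h1, Complex.norm_conj, hc1 _ h2]; simp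
  have e6 : s * N * Λ.card ≤ ∑ t ∈ Λ, ‖SS h N t‖ := by
    rw [mul_comm, ← nsmul_eq_mul, ← sum_const]
    exact sum_le_sum fun t ht => mem_Sp.1 (hΛ ht)
  have e7 : s ^ 2 * N * (Λ.card : ℝ) ^ 2 ≤ ∑ q ∈ Λ ×ˢ Λ, ‖SS h N (q.1 - q.2)‖ := by
    have : N * (s ^ 2 * N * (Λ.card : ℝ) ^ 2) ≤ N * ∑ q ∈ Λ ×ˢ Λ, ‖SS h N (q.1 - q.2)‖ := by
      calc _ = (s * N * Λ.card) ^ 2 := by ring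
        _ ≤ (∑ t ∈ Λ, ‖SS h N t‖) ^ 2 := by gcongr
        _ ≤ _ := e3.trans (by gcongr)
    exact le_of_mul_le_mul_left this hN0
  have e8 : ∑ q ∈ Λ ×ˢ Λ, ‖SS h N (q.1 - q.2)‖ ≤ ∑ q ∈ Λ ×ˢ Λ,
      (s ^ 2 / 2 * N + if q.1 - q.2 ∈ Sp h N (s ^ 2 / 2) then (N : ℝ) else 0) := by
    refine sum_le_sum fun q _ => ?_
    split_ifs with hq
    · have := SS_norm_le h N (q.1 - q.2)
      have : 0 ≤ s ^ 2 / 2 * N := by positivity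
      linarith
    · rw [mem_Sp, not_le] at hq
      linarith
  rw [sum_add_distrib, ← sum_filter, sum_const, sum_const, card_product, nsmul_eq_mul,
    nsmul_eq_mul] at e8
  push_cast at e8
  have e9 : N * (s ^ 2 / 2 * (Λ.card : ℝ) ^ 2) ≤
      N * ((Λ ×ˢ Λ).filter (fun x => x.1 - x.2 ∈ Sp h N (s ^ 2 / 2))).card := by
    nlinarith
  exact le_of_mul_le_mul_left e9 hN0

theorem SS_shift1 {p : ℕ} [Fact p.Prime] (h : ZMod p) (N : ℕ) (t : ZMod p) :
    ‖SS h N t‖ ≤ ‖SS h N (h * t)‖ + 2 := by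
  have e : SS h N t + ee (t * h ^ (N + 1)) = ee (t * h ^ 1) + SS h N (h * t) := by
    induction N with
    | zero => simp [SS]
    | succ n ih =>
      have e1 : ∀ t, SS h (n + 1) t = SS h n t + ee (t * h ^ (n + 1)) := fun t => by
        unfold SS
        rw [Finset.sum_Icc_succ_top (by omega)]
      rw [e1, e1, ih, show h * t * h ^ (n + 1) = t * h ^ (n + 1 + 1) by ring]
      ring
  have e' : SS h N t = SS h N (h * t) + ee (t * h ^ 1) - ee (t * h ^ (N + 1)) := by
    linear_combination e
  rw [e']
  refine (norm_sub_le _ _).trans ?_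
  have := norm_add_le (SS h N (h * t)) (ee (t * h ^ 1))
  rw [ee_norm] at *
  linarith

theorem SS_shift {p : ℕ} [Fact p.Prime] (h : ZMod p) (N : ℕ) (t : ZMod p) (j : ℕ) :
    ‖SS h N t‖ ≤ ‖SS h N (h ^ j * t)‖ + 2 * j := by
  induction j with
  | zero => simp
  | succ j ih =>
    have := SS_shift1 h N (h ^ j * t)
    rw [← mul_assoc, ← pow_succ'] at this
    push_cast
    linarith

end fourier


theorem inter_pig {α ι : Type*} [DecidableEq α] (I : Finset ι) (hI : I.Nonempty)
    (f : ι → Finset α) (Ω : Finset α) (hf : ∀ i ∈ I, f i ⊆ Ω) (b : ℕ) (hb : ∀ i ∈ I, (f i).card = b) :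
    ∃ i0 ∈ I, (I.card : ℝ) * (b : ℝ) ^ 2 ≤ Ω.card * ∑ i ∈ I, ((f i ∩ f i0).card : ℝ) := by
  classical
  have e1 : (I.card : ℝ) * b = ∑ x ∈ Ω, ∑ i ∈ I, if x ∈ f i then (1 : ℝ) else 0 := by
    rw [sum_comm, ← nsmul_eq_mul, ← sum_const]
    refine sum_congr rfl fun i hi => ?_
    rw [← hb i hi, ← sum_filter, sum_const, nsmul_eq_mul, mul_one, filter_mem_eq_inter,
      inter_eq_right.2 (hf i hi)]
  have e2 : ∑ x ∈ Ω, (∑ i ∈ I, if x ∈ f i then (1 : ℝ) else 0) ^ 2 =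
      ∑ j ∈ I, ∑ i ∈ I, ((f i ∩ f j).card : ℝ) := by
    simp only [sq, sum_mul_sum]
    rw [sum_comm]
    rw [sum_comm (s := I) (t := I)]
    refine sum_congr rfl fun i hi => ?_
    rw [sum_comm]
    refine sum_congr rfl fun j _ => ?_
    have : ∀ x ∈ Ω, (if x ∈ f i then (1 : ℝ) else 0) * (if x ∈ f j then (1 : ℝ) else 0) =
        if x ∈ f i ∩ f j then (1 : ℝ) else 0 := by
      intro x _
      by_cases h1 : x ∈ f i <;> by_cases h2 : x ∈ f j <;> simp [h1, h2]
    rw [sum_congr rfl this, ← sum_filter, sum_const, nsmul_eq_mul, mul_one, filter_mem_eq_inter,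
      inter_eq_right.2 (inter_subset_left.trans (hf i hi))]
  have e3 : ((I.card : ℝ) * b) ^ 2 ≤ Ω.card * ∑ j ∈ I, ∑ i ∈ I, ((f i ∩ f j).card : ℝ) := by
    rw [e1, ← e2]; exact sq_sum_le_card_mul_sum_sq
  obtain ⟨i0, hi0, h⟩ := exists_le_of_sum_le (s := I) (f := fun _ => (I.card : ℝ) * (b : ℝ) ^ 2)
    (g := fun j => Ω.card * ∑ i ∈ I, ((f i ∩ f j).card : ℝ)) hI (by
      rw [sum_const, nsmul_eq_mul, ← mul_sum]
      calc _ = ((I.card : ℝ) * b) ^ 2 := by ring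
        _ ≤ _ := e3)
  exact ⟨i0, hi0, h⟩

theorem aux_fs (M J b g : ℝ) (hM : 0 < M) : (2 * M ^ 2 * b) * (J * (b / (4 * M ^ 2)) + g * b) =
    (J / 2 + 2 * M ^ 2 * g) * b ^ 2 := by
  field_simp
  ring

set_option maxHeartbeats 1000000 in
open scoped Pointwise in
theorem sp_core {p : ℕ} [Fact p.Prime] (h : ZMod p) (hh : h ≠ 0) (N : ℕ) (hN2 : 2 ≤ N)
    (hNp : (N : ℝ) ^ 2 ≤ p) (hinj : Set.InjOn (fun y : ℕ => h ^ y) (Set.Iic N))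
    (M θ : ℝ) (hM : 2 ≤ M) (hθ0 : 0 < θ) (hθ : θ ≤ 1 / 2) (hMθ : 1 ≤ M * θ ^ 2)
    (hsp : ((Sp h N (2 * θ ^ 2)).card : ℝ) ≤ M * (Sp h N (2 * θ)).card)
    (hMN : M ^ 1438 ≤ N) :
    ((Sp h N (2 * θ)).card : ℝ) * (N : ℝ) ^ 2 ≤ M ^ 1438 * p := by
  classical
  have hN1 : 1 ≤ N := by omega
  have hN0 : (0 : ℝ) < N := by exact_mod_cast hN1
  have hM1 : 1 ≤ M := by linarith
  have hM0 : 0 < M := by linarith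
  have hpp : (0 : ℝ) < p := by exact_mod_cast (Fact.out : p.Prime).pos
  have hinj' : Set.InjOn (fun y : ℕ => h ^ y) (Icc 1 N : Finset ℕ) :=
    hinj.mono (fun y hy => by rw [mem_coe, mem_Icc] at hy; exact hy.2)
  set Λ := Sp h N (2 * θ) with hΛ
  set Ω := Sp h N (2 * θ ^ 2) with hΩ
  have hΛne : Λ.Nonempty := by
    refine ⟨0, mem_Sp.2 ?_⟩
    have : ‖SS h N 0‖ = N := by simp [SS, ee_zero]
    rw [this]
    nlinarith
  have hΛpos : (0 : ℝ) < Λ.card := by exact_mod_cast hΛne.card_pos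
  have hdiff := Sp_diff h N hN1 (2 * θ) (by positivity) Λ (Subset.refl _)
  rw [show (2 * θ) ^ 2 / 2 = 2 * θ ^ 2 by ring, ← hΩ] at hdiff
  obtain ⟨B, hBΛ, hBcard, hBB⟩ := bsg_aux Λ Ω (2 * θ ^ 2) (by positivity) hΛne hdiff
  have himg : (B ×ˢ B).image (fun x => x.1 - x.2) = B - B := by
    rw [← image_sub_product]
  rw [himg] at hBB
  -- lower bound on B
  have hB1 : (Λ.card : ℝ) ≤ 2 * M * B.card := by
    have : (1 : ℝ) * Λ.card ≤ (M * θ ^ 2) * Λ.card := by gcongr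
    nlinarith
  have hBpos : (0 : ℝ) < B.card := by
    by_contra hc
    have : (B.card : ℝ) = 0 := le_antisymm (not_lt.1 hc) (by positivity)
    rw [this] at hB1; linarith
  have hBne : B.Nonempty := by
    rw [← card_pos]; exact_mod_cast hBpos
  -- doubling
  have hBB2 : ((B - B).card : ℝ) ≤ M ^ 18 * B.card := by
    have h1 : ((B - B).card : ℝ) * ((2 * θ ^ 2) ^ 5 / 4096) * (Λ.card : ℝ) ^ 3 ≤ (M ^ 4 * Λ.card) * (Λ.card : ℝ) ^ 3 := by
      calc _ = ((B - B).card : ℝ) * ((2 * θ ^ 2) ^ 5 / 4096 * (Λ.card : ℝ) ^ 3) := by ring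
        _ ≤ (Ω.card : ℝ) ^ 4 := hBB
        _ ≤ (M * Λ.card) ^ 4 := by gcongr
        _ = _ := by ring
    have h2 := le_of_mul_le_mul_right h1 (by positivity)
    have h3 : ((B - B).card : ℝ) * 1 ≤ ((B - B).card : ℝ) * (M * θ ^ 2) ^ 5 := by
      gcongr
      exact one_le_pow₀ hMθ
    have h4 : ((B - B).card : ℝ) ≤ 128 * M ^ 9 * Λ.card := by
      calc ((B - B).card : ℝ) ≤ ((B - B).card : ℝ) * (M * θ ^ 2) ^ 5 := by linarith
        _ = (128 * M ^ 5) * (((B - B).card : ℝ) * ((2 * θ ^ 2) ^ 5 / 4096)) := by ring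
        _ ≤ (128 * M ^ 5) * (M ^ 4 * Λ.card) := by gcongr
        _ = _ := by ring
    calc ((B - B).card : ℝ) ≤ 128 * M ^ 9 * (2 * M * B.card) := h4.trans (by gcongr)
      _ = (2 : ℝ) ^ 8 * (M ^ 10 * B.card) := by ring
      _ ≤ M ^ 8 * (M ^ 10 * B.card) := by gcongr
      _ = _ := by ring
  -- shifts
  set J := ⌊θ * N / 2⌋₊ + 1 with hJ
  have hJlow : θ * N / 2 ≤ J := by rw [hJ]; push_cast; exact (Nat.lt_floor_add_one _).le
  have hJup : J ≤ N := by
    have : ⌊θ * N / 2⌋₊ ≤ N / 2 := by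
      rw [← Nat.floor_div_eq_div (K := ℝ)]
      apply Nat.floor_le_floor
      push_cast
      nlinarith
    omega
  let f : ℕ → Finset (ZMod p) := fun j => B.image (h ^ j * ·)
  have hf : ∀ j ∈ range J, f j ⊆ Ω := by
    intro j hj x hx
    obtain ⟨b, hb, rfl⟩ := mem_image.1 hx
    have h1 := mem_Sp.1 (hBΛ hb)
    have h2 := SS_shift h N b j
    have h3 : (j : ℝ) ≤ θ * N / 2 := by
      have : j ≤ ⌊θ * N / 2⌋₊ := by rw [mem_range] at hj; omega
      exact (Nat.cast_le.2 this).trans (Nat.floor_le (by positivity))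
    rw [hΩ, mem_Sp]
    have : θ * θ * N ≤ 1 / 2 * θ * N := by gcongr
    nlinarith
  have hfc : ∀ j ∈ range J, (f j).card = B.card := fun j _ =>
    card_image_of_injective _ (mul_right_injective₀ (pow_ne_zero _ hh))
  obtain ⟨j0, hj0, hpig⟩ := inter_pig (range J) ⟨0, by simp [hJ]⟩ f Ω hf B.card hfc
  rw [card_range] at hpig
  set gd := (range J).filter (fun j => (B.card : ℝ) ≤ 4 * M ^ 2 * (f j ∩ f j0).card) with hgd
  have hΩB : (Ω.card : ℝ) ≤ 2 * M ^ 2 * B.card := by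
    calc (Ω.card : ℝ) ≤ M * Λ.card := hsp
      _ ≤ M * (2 * M * B.card) := by gcongr
      _ = _ := by ring
  have hgdc : (J : ℝ) ≤ 4 * M ^ 2 * gd.card := by
    have h1 : ∑ i ∈ range J, ((f i ∩ f j0).card : ℝ) ≤ ∑ i ∈ range J,
        ((B.card : ℝ) / (4 * M ^ 2) + if (B.card : ℝ) ≤ 4 * M ^ 2 * (f i ∩ f j0).card then (B.card : ℝ) else 0) := by
      refine sum_le_sum fun i hi => ?_
      split_ifs with hc
      · have : ((f i ∩ f j0).card : ℝ) ≤ B.card := by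
          rw [← hfc i hi]; exact_mod_cast card_le_card inter_subset_left
        have : 0 ≤ (B.card : ℝ) / (4 * M ^ 2) := by positivity
        linarith
      · rw [not_le] at hc
        rw [add_zero, le_div_iff₀ (by positivity)]
        linarith
    rw [sum_add_distrib, ← sum_filter, sum_const, sum_const, card_range, nsmul_eq_mul, nsmul_eq_mul, ← hgd] at h1
    have h2 : (J : ℝ) * (B.card : ℝ) ^ 2 ≤ (2 * M ^ 2 * B.card) * (J * ((B.card : ℝ) / (4 * M ^ 2)) + gd.card * B.card) :=
      hpig.trans (mul_le_mul hΩB h1 (sum_nonneg fun _ _ => Nat.cast_nonneg _)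
        (mul_nonneg (mul_nonneg zero_le_two (sq_nonneg M)) (Nat.cast_nonneg _)))
    have h3 : (2 * M ^ 2 * B.card) * (J * ((B.card : ℝ) / (4 * M ^ 2)) + gd.card * B.card) =
        (J / 2 + 2 * M ^ 2 * gd.card) * (B.card : ℝ) ^ 2 := aux_fs M J B.card gd.card hM0
    rw [h3] at h2
    have h4 := le_of_mul_le_mul_right h2 (by positivity)
    linarith
  set H := gd.image (fun j => h ^ j / h ^ j0) with hH
  have hHc : H.card = gd.card := by
    rw [hH]
    apply card_image_of_injOn
    intro a ha b hb hab
    have hj : h ^ j0 ≠ 0 := pow_ne_zero _ hh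
    simp only at hab
    rw [div_left_inj' hj] at hab
    have ha' := mem_range.1 (mem_filter.1 (mem_coe.1 ha)).1
    have hb' := mem_range.1 (mem_filter.1 (mem_coe.1 hb)).1
    exact hinj (Set.mem_Iic.2 (by omega)) (Set.mem_Iic.2 (by omega)) hab
  have hHN : (N : ℝ) ≤ M ^ 6 * H.card := by
    rw [hHc]
    have h1 : θ * N / 2 ≤ 4 * M ^ 2 * gd.card := hJlow.trans hgdc
    have h2 : 1 ≤ M * θ := by
      have : M * θ ^ 2 ≤ M * θ := by
        have : θ ^ 2 ≤ θ := by nlinarith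
        gcongr
      linarith
    calc (N : ℝ) ≤ (M * θ) * N := by nlinarith
      _ = 2 * M * (θ * N / 2) := by ring
      _ ≤ 2 * M * (4 * M ^ 2 * gd.card) := by gcongr
      _ = (2 : ℝ) ^ 3 * (M ^ 3 * gd.card) := by ring
      _ ≤ M ^ 3 * (M ^ 3 * gd.card) := by gcongr
      _ = _ := by ring
  have hH2 : 2 ≤ H.card := by
    have h1 : M ^ 7 ≤ M ^ 6 * H.card := by
      refine le_trans ?_ hHN
      exact (pow_le_pow_right₀ hM1 (by norm_num)).trans hMN
    have h2 : M ^ 6 * M ≤ M ^ 6 * H.card := by linarith [pow_succ M 6]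
    have h3 := le_of_mul_le_mul_left h2 (by positivity)
    exact_mod_cast hM.trans h3
  have hHp : (H.card : ℝ) ^ 2 ≤ p := by
    refine le_trans ?_ hNp
    have : H.card ≤ N := by
      rw [hHc]
      exact (card_filter_le _ _).trans (by rw [card_range]; exact hJup)
    gcongr
  have hHint : ∀ y ∈ H, (B.card : ℝ) ≤ M ^ 18 * (B ∩ B.image (y * ·)).card := by
    intro y hy
    obtain ⟨j, hj, rfl⟩ := mem_image.1 hy
    have h1 := (mem_filter.1 hj).2
    have hj0' : h ^ j0 ≠ 0 := pow_ne_zero _ hh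
    have h2 : (f j ∩ f j0).card ≤ (B ∩ B.image ((h ^ j / h ^ j0) * ·)).card := by
      rw [← card_image_of_injective (B ∩ B.image ((h ^ j / h ^ j0) * ·)) (mul_right_injective₀ hj0')]
      apply card_le_card
      intro x hx
      obtain ⟨hx1, hx2⟩ := mem_inter.1 hx
      obtain ⟨b1, hb1, e1⟩ := mem_image.1 hx1
      obtain ⟨b2, hb2, e2⟩ := mem_image.1 hx2
      refine mem_image.2 ⟨b2, mem_inter.2 ⟨hb2, mem_image.2 ⟨b1, hb1, ?_⟩⟩, e2⟩
      rw [div_mul_eq_mul_div, e1, ← e2, mul_div_cancel_left₀ _ hj0']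
    calc (B.card : ℝ) ≤ 4 * M ^ 2 * (f j ∩ f j0).card := h1
      _ ≤ 4 * M ^ 2 * (B ∩ B.image ((h ^ j / h ^ j0) * ·)).card := by gcongr
      _ = (2 : ℝ) ^ 2 * (M ^ 2 * (B ∩ B.image ((h ^ j / h ^ j0) * ·)).card) := by ring
      _ ≤ M ^ 16 * (M ^ 2 * (B ∩ B.image ((h ^ j / h ^ j0) * ·)).card) := by
          have : (2 : ℝ) ^ 2 ≤ M ^ 16 :=
            (pow_le_pow_left₀ (by norm_num) hM 2).trans (pow_le_pow_right₀ hM1 (by norm_num))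
          gcongr
      _ = _ := by ring
  have hΛup : (Λ.card : ℝ) * N ≤ M * p := by
    have h1 := Sp_card h N hN1 hinj' (2 * θ) (by positivity)
    rw [← hΛ] at h1
    have h2 : (Λ.card : ℝ) * N * 1 ≤ (Λ.card : ℝ) * N * (M * θ ^ 2) := by gcongr
    have h3 : 0 ≤ (Λ.card : ℝ) * N := by positivity
    nlinarith
  have hBΛc : (B.card : ℝ) ≤ Λ.card := by exact_mod_cast card_le_card hBΛ
  have hBp : 2 * (M ^ 18) ^ 79 * B.card ≤ p := by
    have h1 : M ^ 1423 * B.card * M ≤ p * M := by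
      have h2 : M ^ 1424 ≤ N := (pow_le_pow_right₀ hM1 (by norm_num)).trans hMN
      calc M ^ 1423 * B.card * M = M ^ 1424 * B.card := by
            rw [show M ^ 1424 = M ^ 1423 * M from pow_succ M 1423]; ring
        _ ≤ (N : ℝ) * Λ.card := by gcongr
        _ = (Λ.card : ℝ) * N := by ring
        _ ≤ M * p := hΛup
        _ = _ := by ring
    have h3 := le_of_mul_le_mul_right h1 hM0
    refine le_trans ?_ h3
    rw [← pow_mul, show M ^ 1423 = M * M ^ 1422 from pow_succ' M 1422]
    gcongr
  have hfin := alg_core B H (M ^ 18) (one_le_pow₀ hM1) hBne hBB2 hHint hH2 hHp hBp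
  rw [← pow_mul] at hfin
  calc (Λ.card : ℝ) * (N : ℝ) ^ 2 ≤ (2 * M * B.card) * (M ^ 6 * H.card) ^ 2 := by gcongr
    _ = 2 * M ^ 13 * ((H.card : ℝ) ^ 2 * B.card) := by ring
    _ ≤ 2 * M ^ 13 * (4 * M ^ (18 * 79) * p) := by gcongr
    _ = (2 : ℝ) ^ 3 * (M ^ 13 * M ^ 1422) * p := by ring
    _ = (2 : ℝ) ^ 3 * M ^ 1435 * p := by rw [← pow_add]
    _ ≤ M ^ 3 * M ^ 1435 * p := by gcongr
    _ = M ^ 1438 * p := by rw [← pow_add]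


theorem Sp_mono {p : ℕ} [Fact p.Prime] (h : ZMod p) (N : ℕ) {s s' : ℝ} (hs : s ≤ s') :
    Sp h N s' ⊆ Sp h N s := by
  intro t ht
  rw [mem_Sp] at *
  refine le_trans ?_ ht
  gcongr

theorem star (ε : ℝ) (hε : 0 < ε) : ∃ η : ℝ, 0 < η ∧ ∃ N0 : ℕ, ∀ (p : ℕ) [Fact p.Prime]
    (h : ZMod p) (N : ℕ), h ≠ 0 → N0 ≤ N → (N : ℝ) ^ 2 ≤ p →
    Set.InjOn (fun y : ℕ => h ^ y) (Set.Iic N) →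
    ((Sp h N ((N : ℝ) ^ (-η))).card : ℝ) ≤ p * (N : ℝ) ^ (ε - 2) := by
  obtain ⟨n, hn⟩ := exists_nat_ge (max 1438 (1438 / ε))
  have hn1 : (1438 : ℝ) ≤ n := (le_max_left _ _).trans hn
  have hn2 : 1438 / ε ≤ n := (le_max_right _ _).trans hn
  have hn0 : (0 : ℝ) < n := by linarith
  have hn' : 1438 ≤ n := by exact_mod_cast hn1
  obtain ⟨m, hm⟩ : ∃ m, m = n * 4 ^ n := ⟨_, rfl⟩
  have hm0 : 0 < m := by rw [hm]; positivity
  have hmR : (0 : ℝ) < m := by exact_mod_cast hm0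
  refine ⟨1 / (2 * m), by positivity, 4 ^ m, ?_⟩
  intro p _ h N hh hN hNp hinj
  have hNge : (4 : ℝ) ^ m ≤ N := by exact_mod_cast hN
  have hN0 : (0 : ℝ) < N := lt_of_lt_of_le (by positivity) hNge
  have hN2 : 2 ≤ N := by
    have : 4 ^ 1 ≤ 4 ^ m := Nat.pow_le_pow_right (by norm_num) hm0
    omega
  have hN1 : (1 : ℝ) ≤ N := by exact_mod_cast (by omega : 1 ≤ N)
  have hpp : (0 : ℝ) < p := by exact_mod_cast (Fact.out : p.Prime).pos
  set θ : ℝ := (N : ℝ) ^ (-(1 / (m : ℝ))) with hθ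
  have hθ0 : 0 < θ := by positivity
  have hθm : θ ^ m = (N : ℝ)⁻¹ := by
    rw [hθ, ← Real.rpow_natCast, ← Real.rpow_mul hN0.le]
    rw [show -(1 / (m : ℝ)) * m = -1 by field_simp, Real.rpow_neg_one]
  have hθ4 : θ ≤ 1 / 4 := by
    have : θ ^ m ≤ (1 / 4) ^ m := by
      rw [hθm, one_div, inv_pow]
      exact inv_anti₀ (by positivity) hNge
    exact le_of_pow_le_pow_left₀ hm0.ne' (by norm_num) this
  set M : ℝ := (N : ℝ) ^ (1 / (n : ℝ)) with hM
  have hM0 : 0 < M := by positivity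
  have hMn : M ^ n = N := by
    rw [hM, ← Real.rpow_natCast, ← Real.rpow_mul hN0.le]
    rw [show (1 / (n : ℝ)) * n = 1 by field_simp, Real.rpow_one]
  have hM2 : 2 ≤ M := by
    have : (2 : ℝ) ^ n ≤ M ^ n := by
      rw [hMn]
      refine le_trans ?_ hNge
      calc (2 : ℝ) ^ n ≤ 4 ^ n := by gcongr; norm_num
        _ ≤ 4 ^ m := by
          apply pow_le_pow_right₀ (by norm_num)
          rw [hm]; exact Nat.le_mul_of_pos_right _ (by positivity)
    exact le_of_pow_le_pow_left₀ (by omega) hM0.le this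
  have hM1 : 1 ≤ M := by linarith
  have hMN : M ^ 1438 ≤ N := by
    rw [← hMn]; exact pow_le_pow_right₀ hM1 hn'
  have hMε : M ^ 1438 ≤ (N : ℝ) ^ ε := by
    rw [hM, ← Real.rpow_natCast, ← Real.rpow_mul hN0.le]
    apply Real.rpow_le_rpow_of_exponent_le hN1
    rw [div_le_iff₀ hε] at hn2
    rw [one_div, inv_mul_le_iff₀ hn0]
    push_cast
    linarith
  have hθM : θ ^ (4 ^ n) = M⁻¹ := by
    have h1 : (θ ^ (4 ^ n)) ^ n = (M⁻¹) ^ n := by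
      rw [inv_pow, hMn, ← pow_mul, mul_comm, ← hm, hθm]
    exact (pow_left_inj₀ (by positivity) (by positivity) (by omega)).1 h1
  have hkey : ((Sp h N (2 * θ)).card : ℝ) * (N : ℝ) ^ 2 ≤ (N : ℝ) ^ ε * p := by
    by_cases hc : ∃ k < 2 * n, ((Sp h N (2 * θ ^ (2 ^ (k + 1)))).card : ℝ) ≤
        M * (Sp h N (2 * θ ^ (2 ^ k))).card
    · obtain ⟨k, hk, hsp⟩ := hc
      have hle : θ ^ (2 ^ k) ≤ θ := by
        calc θ ^ (2 ^ k) ≤ θ ^ 1 := pow_le_pow_of_le_one hθ0.le (by linarith) (Nat.one_le_two_pow)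
          _ = θ := pow_one _
      have hMθ : 1 ≤ M * (θ ^ (2 ^ k)) ^ 2 := by
        have : M⁻¹ ≤ (θ ^ (2 ^ k)) ^ 2 := by
          rw [← hθM, ← pow_mul, ← pow_succ]
          apply pow_le_pow_of_le_one hθ0.le (by linarith)
          calc 2 ^ (k + 1) ≤ 2 ^ (2 * n) := Nat.pow_le_pow_right (by norm_num) (by omega)
            _ = 4 ^ n := by rw [pow_mul]; norm_num
        calc 1 = M * M⁻¹ := (mul_inv_cancel₀ hM0.ne').symm
          _ ≤ _ := by gcongr
      have hcore := sp_core h hh N hN2 hNp hinj M (θ ^ (2 ^ k)) hM2 (by positivity)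
        (by linarith) hMθ (by rw [← pow_mul, ← pow_succ]; exact hsp) hMN
      calc ((Sp h N (2 * θ)).card : ℝ) * (N : ℝ) ^ 2 ≤
            ((Sp h N (2 * θ ^ (2 ^ k))).card : ℝ) * (N : ℝ) ^ 2 := by
            have := card_le_card (Sp_mono h N (show 2 * θ ^ (2 ^ k) ≤ 2 * θ by linarith))
            gcongr
        _ ≤ M ^ 1438 * p := hcore
        _ ≤ _ := by gcongr
    · push Not at hc
      have hind : ∀ k ≤ 2 * n, M ^ k * ((Sp h N (2 * θ)).card : ℝ) ≤
          (Sp h N (2 * θ ^ (2 ^ k))).card := by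
        intro k
        induction k with
        | zero => simp
        | succ k ih =>
          intro hk
          have h1 := ih (by omega)
          have h2 := hc k (by omega)
          rw [pow_succ']
          calc _ = M * (M ^ k * ((Sp h N (2 * θ)).card : ℝ)) := by ring
            _ ≤ M * (Sp h N (2 * θ ^ (2 ^ k))).card := by gcongr
            _ ≤ _ := h2.le
      have h3 := hind (2 * n) le_rfl
      have h4 : ((Sp h N (2 * θ ^ (2 ^ (2 * n)))).card : ℝ) ≤ p := by
        have := card_le_univ (Sp h N (2 * θ ^ (2 ^ (2 * n))))
        rw [ZMod.card] at this
        exact_mod_cast this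
      rw [mul_comm 2 n, pow_mul, hMn] at h3
      have h5 : 1 ≤ (N : ℝ) ^ ε := Real.one_le_rpow hN1 hε.le
      rw [mul_comm 2 n] at h4
      calc _ = (N : ℝ) ^ 2 * ((Sp h N (2 * θ)).card : ℝ) := by ring
        _ ≤ 1 * p := by linarith
        _ ≤ _ := by gcongr
  have hη : 2 * θ ≤ (N : ℝ) ^ (-(1 / (2 * (m : ℝ)))) := by
    set φ := (N : ℝ) ^ (-(1 / (2 * (m : ℝ)))) with hφ
    have h1 : φ ^ 2 = θ := by
      rw [hφ, hθ, ← Real.rpow_natCast, ← Real.rpow_mul hN0.le]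
      congr 1
      push_cast
      field_simp
    have h2 : 0 < φ := by positivity
    have h3 : φ ≤ 1 / 2 := by nlinarith
    nlinarith
  have h6 := card_le_card (Sp_mono h N hη)
  rw [Real.rpow_sub hN0, Real.rpow_two, mul_div_assoc', le_div_iff₀ (by positivity)]
  calc _ ≤ ((Sp h N (2 * θ)).card : ℝ) * (N : ℝ) ^ 2 := by gcongr
    _ ≤ _ := by linarith


theorem pow_large (a : ℝ) (ha : 0 < a) (C : ℝ) : ∃ N0 : ℕ, ∀ N : ℕ, N0 ≤ N → C ≤ (N : ℝ) ^ a := by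
  have h := ((tendsto_rpow_atTop ha).comp tendsto_natCast_atTop_atTop).eventually_ge_atTop C
  obtain ⟨N0, hN0⟩ := Filter.eventually_atTop.1 h
  exact ⟨N0, hN0⟩

theorem log_small (a : ℝ) (ha : 0 < a) (c : ℝ) (hc : 0 < c) : ∃ N0 : ℕ, ∀ N : ℕ, N0 ≤ N →
    Real.log N ≤ c * (N : ℝ) ^ a := by
  have h := tendsto_natCast_atTop_atTop.eventually
    ((isLittleO_log_rpow_atTop ha).def hc)
  obtain ⟨N0, hN0⟩ := Filter.eventually_atTop.1 h
  refine ⟨N0, fun N hN => ?_⟩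
  have := hN0 N hN
  rw [Real.norm_of_nonneg (by positivity : (0 : ℝ) ≤ (N : ℝ) ^ a)] at this
  exact (le_abs_self _).trans this

/-- primes up to `K` -/
def PP (K : ℕ) : Finset ℕ := (Icc 1 K).filter Nat.Prime

theorem prime_count (ε : ℝ) (hε : 0 < ε) : ∃ N0 : ℕ, ∀ N : ℕ, N0 ≤ N →
    (N : ℝ) ^ (1 - ε) ≤ (PP N).card := by
  obtain ⟨N1, h1⟩ := log_small 1 one_pos (1 / 10) (by norm_num)
  obtain ⟨N2, h2⟩ := log_small ε hε (1 / 4) (by norm_num)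
  refine ⟨max (max N1 N2) 100, fun N hN => ?_⟩
  have hN1 := h1 N (by omega)
  have hN2 := h2 N (by omega)
  have hN100 : 100 ≤ N := by omega
  have hNR : (100 : ℝ) ≤ N := by exact_mod_cast hN100
  have hc : (PP N).card = Nat.primeCounting N := by
    rw [Nat.primeCounting, Nat.primeCounting', Nat.count_eq_card_filter_range, PP]
    congr 1
    ext x
    simp only [mem_filter, mem_Icc, mem_range]
    constructor
    · rintro ⟨⟨a, b⟩, c⟩; exact ⟨by omega, c⟩
    · rintro ⟨a, c⟩; exact ⟨⟨c.one_le, by omega⟩, c⟩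
  have hpi := Chebyshev.pi_ge N
  rw [hc]
  refine le_trans ?_ hpi
  have hlogpos : 0 < Real.log N := Real.log_pos (by linarith)
  rw [le_div_iff₀ hlogpos]
  have hl2 : Real.log (N + 1) ≤ Real.log 2 + Real.log N := by
    rw [← Real.log_mul (by norm_num) (by linarith)]
    exact Real.log_le_log (by linarith) (by linarith)
  have := Real.log_two_gt_d9
  have := Real.log_two_lt_d9
  rw [Real.rpow_one] at hN1
  calc (N : ℝ) ^ (1 - ε) * Real.log N ≤ (N : ℝ) ^ (1 - ε) * (1 / 4 * (N : ℝ) ^ ε) := by gcongr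
    _ = 1 / 4 * ((N : ℝ) ^ (1 - ε) * (N : ℝ) ^ ε) := by ring
    _ = 1 / 4 * N := by
      rw [← Real.rpow_add (by linarith)]; simp
    _ ≤ _ := by nlinarith

/-- additive quadruples of powers -/
def T2 {p : ℕ} (h : ZMod p) (N : ℕ) : ℕ :=
  (((Icc 1 N ×ˢ Icc 1 N) ×ˢ (Icc 1 N ×ˢ Icc 1 N)).filter
    (fun q => h ^ q.1.1 + h ^ q.1.2 = h ^ q.2.1 + h ^ q.2.2)).card

theorem SS_sq {p : ℕ} [Fact p.Prime] (h : ZMod p) (N : ℕ) (t : ZMod p) :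
    SS h N t ^ 2 = ∑ q ∈ Icc 1 N ×ˢ Icc 1 N, ee (t * (h ^ q.1 + h ^ q.2)) := by
  rw [sq, SS, sum_mul_sum, sum_product]
  refine sum_congr rfl fun i _ => sum_congr rfl fun j _ => ?_
  rw [mul_add, ee_add]

theorem T2_bound : ∃ δ : ℝ, 0 < δ ∧ δ ≤ 1 / 40 ∧ ∃ N0 : ℕ, ∀ (p : ℕ) [Fact p.Prime]
    (h : ZMod p) (N : ℕ), h ≠ 0 → N0 ≤ N → (N : ℝ) ^ 2 ≤ p →
    Set.InjOn (fun y : ℕ => h ^ y) (Set.Iic N) →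
    (T2 h N : ℝ) ≤ (N : ℝ) ^ (3 - 2 * δ) := by
  obtain ⟨η, hη, N1, hstar⟩ := star (1 / 2) (by norm_num)
  obtain ⟨δ, hδ⟩ : ∃ δ, δ = min (η / 2) (1 / 40) := ⟨_, rfl⟩
  have hδ0 : 0 < δ := by rw [hδ]; positivity
  have hδ1 : δ ≤ η / 2 := hδ ▸ min_le_left _ _
  have hδ2 : δ ≤ 1 / 40 := hδ ▸ min_le_right _ _
  obtain ⟨N2, hlarge⟩ := pow_large (2 * δ) (by positivity) 2
  refine ⟨δ, hδ0, hδ2, max (max N1 N2) 1, ?_⟩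
  intro p _ h N hh hN hNp hinj
  have hN1 : 1 ≤ N := by omega
  have hNR : (1 : ℝ) ≤ N := by exact_mod_cast hN1
  have hN0 : (0 : ℝ) < N := by linarith
  have hpp : (0 : ℝ) < p := by exact_mod_cast (Fact.out : p.Prime).pos
  have hst := hstar p h N hh (by omega) hNp hinj
  have hla := hlarge N (by omega)
  have hinj' : Set.InjOn (fun y : ℕ => h ^ y) (Icc 1 N : Finset ℕ) :=
    hinj.mono (fun y hy => by rw [mem_coe, mem_Icc] at hy; exact hy.2)
  set s := (N : ℝ) ^ (-η) with hs
  have horth := orth (Icc 1 N ×ˢ Icc 1 N) (fun q => h ^ q.1 + h ^ q.2)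
  simp only [← SS_sq] at horth
  have hT : ∑ t : ZMod p, ‖SS h N t ^ 2‖ ^ 2 = p * (T2 h N : ℝ) := horth
  have hle : ∑ t : ZMod p, ‖SS h N t ^ 2‖ ^ 2 ≤ ∑ t : ZMod p,
      ((if t ∈ Sp h N s then (N : ℝ) ^ 4 else 0) + s ^ 2 * N ^ 2 * ‖SS h N t‖ ^ 2) := by
    refine sum_le_sum fun t _ => ?_
    rw [norm_pow, ← pow_mul]
    split_ifs with ht
    · have := SS_norm_le h N t
      have : ‖SS h N t‖ ^ (2 * 2) ≤ (N : ℝ) ^ 4 := by gcongr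
      have : 0 ≤ s ^ 2 * N ^ 2 * ‖SS h N t‖ ^ 2 := by positivity
      linarith
    · rw [mem_Sp, not_le] at ht
      rw [zero_add]
      calc ‖SS h N t‖ ^ (2 * 2) = ‖SS h N t‖ ^ 2 * ‖SS h N t‖ ^ 2 := by ring
        _ ≤ (s * N) ^ 2 * ‖SS h N t‖ ^ 2 := by gcongr
        _ = _ := by ring
  rw [hT, sum_add_distrib, ← sum_filter, sum_const, ← mul_sum, SS_parseval h N hinj', nsmul_eq_mul,
    filter_mem_eq_inter, univ_inter] at hle
  have h1 : p * (T2 h N : ℝ) ≤ p * ((N : ℝ) ^ (1 / 2 - 2 : ℝ) * N ^ 4 + s ^ 2 * N ^ 3) := by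
    calc _ ≤ _ := hle
      _ ≤ (p * (N : ℝ) ^ (1 / 2 - 2 : ℝ)) * N ^ 4 + s ^ 2 * N ^ 2 * (p * N) := by gcongr
      _ = _ := by ring
  have h2 := le_of_mul_le_mul_left h1 hpp
  have e1 : (N : ℝ) ^ (1 / 2 - 2 : ℝ) * (N : ℝ) ^ 4 ≤ (N : ℝ) ^ (3 - 4 * δ) := by
    rw [← Real.rpow_natCast, ← Real.rpow_add hN0]
    apply Real.rpow_le_rpow_of_exponent_le hNR
    push_cast
    linarith
  have e2 : s ^ 2 * (N : ℝ) ^ 3 ≤ (N : ℝ) ^ (3 - 4 * δ) := by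
    rw [hs, ← Real.rpow_natCast, ← Real.rpow_natCast, ← Real.rpow_mul hN0.le, ← Real.rpow_add hN0]
    apply Real.rpow_le_rpow_of_exponent_le hNR
    push_cast
    linarith
  calc (T2 h N : ℝ) ≤ 2 * (N : ℝ) ^ (3 - 4 * δ) := by linarith
    _ ≤ (N : ℝ) ^ (2 * δ) * (N : ℝ) ^ (3 - 4 * δ) := by gcongr
    _ = _ := by rw [← Real.rpow_add hN0]; congr 1; ring


theorem nat_of_zmod {p m n : ℕ} (hm : m < p) (hn : n < p) (h : (m : ZMod p) = n) : m = n := by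
  rw [ZMod.natCast_eq_natCast_iff'] at h
  rwa [Nat.mod_eq_of_lt hm, Nat.mod_eq_of_lt hn] at h

theorem four_lt {K p a b c d : ℕ} (hK : K ^ 4 < p) (ha : a ≤ K) (hb : b ≤ K) (hc : c ≤ K)
    (hd : d ≤ K) : a * b * (c * d) < p := by
  refine lt_of_le_of_lt ?_ hK
  calc a * b * (c * d) ≤ K * K * (K * K) := by gcongr
    _ = K ^ 4 := by ring

theorem two_lt {K p a b : ℕ} (hK : K ^ 4 < p) (hK1 : 1 ≤ K) (ha : a ≤ K) (hb : b ≤ K) : a * b < p := by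
  have := four_lt hK ha hb hK1 hK1
  simpa using this

theorem prime_ratio {p a b a' b' : ℕ} (h1 : a * b' < p) (h2 : a' * b < p) (ha : a.Prime)
    (hb : b.Prime) (ha' : a'.Prime) (hab : a ≠ b)
    (h : (a : ZMod p) * b' = a' * b) : a = a' ∧ b = b' := by
  have e : a * b' = a' * b := nat_of_zmod h1 h2 (by push_cast; exact h)
  have h3 : a ∣ a' * b := e ▸ Dvd.intro _ rfl
  rcases ha.dvd_mul.1 h3 with h4 | h4
  · have : a = a' := (Nat.prime_dvd_prime_iff_eq ha ha').1 h4
    subst this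
    exact ⟨rfl, (Nat.eq_of_mul_eq_mul_left ha.pos e).symm⟩
  · exact absurd ((Nat.prime_dvd_prime_iff_eq ha hb).1 h4) hab

theorem rho_bip {p : ℕ} [Fact p.Prime] (h : ZMod p) (hh : h ≠ 0) (N K : ℕ) (hK : K ^ 4 < p)
    (hinj : Set.InjOn (fun y : ℕ => h ^ y) (Set.Iic N)) (x : ZMod p) (hx : x ≠ 0)
    (c : ℕ → Prop) (E : Finset (ℕ × ℕ × ℕ))
    (hE : ∀ e ∈ E, (e.1.Prime ∧ e.1 ≤ K ∧ c e.1) ∧ (e.2.1.Prime ∧ e.2.1 ≤ K ∧ ¬ c e.2.1) ∧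
      e.2.2 < N ∧ (e.1 : ZMod p) = e.2.1 * h ^ e.2.2 * x) : E.card ^ 2 ≤ 8 * N := by
  classical
  have hmaps : ∀ q ∈ E ×ˢ E, q.1.2.2 + q.2.2.2 ∈ range (2 * N) := by
    intro q hq
    obtain ⟨h1, h2⟩ := mem_product.1 hq
    have := (hE _ h1).2.2.1
    have := (hE _ h2).2.2.1
    rw [mem_range]; omega
  have hcard : E.card ^ 2 = ∑ σ ∈ range (2 * N),
      ((E ×ˢ E).filter (fun q => q.1.2.2 + q.2.2.2 = σ)).card := by
    rw [← card_eq_sum_card_fiberwise (fun q hq => hmaps q hq), card_product, sq]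
  rw [hcard]
  have hfib : ∀ σ ∈ range (2 * N), ((E ×ˢ E).filter (fun q => q.1.2.2 + q.2.2.2 = σ)).card ≤ 4 := by
    intro σ _
    rcases ((E ×ˢ E).filter (fun q => q.1.2.2 + q.2.2.2 = σ)).eq_empty_or_nonempty with h0 | ⟨q', hq'⟩
    · rw [h0]; simp
    obtain ⟨hq'1, hσ'⟩ := mem_filter.1 hq'
    obtain ⟨m1', m2'⟩ := mem_product.1 hq'1
    obtain ⟨⟨⟨a1', b1', j1'⟩, ⟨a2', b2', j2'⟩⟩⟩ : Nonempty ((ℕ × ℕ × ℕ) × (ℕ × ℕ × ℕ)) := ⟨q'⟩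
    have g1' := hE _ m1'
    have g2' := hE _ m2'
    calc _ ≤ (({q'.1.1, q'.2.1} : Finset ℕ) ×ˢ ({q'.1.2.1, q'.2.2.1} : Finset ℕ)).card := by
          refine card_le_card_of_injOn (fun q => (q.1.1, q.1.2.1)) ?_ ?_
          · intro q hq
            obtain ⟨hq1, hσ⟩ := mem_filter.1 (mem_coe.1 hq)
            obtain ⟨m1, m2⟩ := mem_product.1 hq1
            have g1 := hE _ m1
            have g2 := hE _ m2
            have hprod : q.1.1 * q.2.1 * (q'.1.2.1 * q'.2.2.1) =
                q'.1.1 * q'.2.1 * (q.1.2.1 * q.2.2.1) := by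
              apply nat_of_zmod (four_lt hK g1.1.2.1 g2.1.2.1 g1'.2.1.2.1 g2'.2.1.2.1)
                (four_lt hK g1'.1.2.1 g2'.1.2.1 g1.2.1.2.1 g2.2.1.2.1)
              push_cast
              rw [g1.2.2.2, g2.2.2.2, g1'.2.2.2, g2'.2.2.2]
              have : h ^ q.1.2.2 * h ^ q.2.2.2 = h ^ q'.1.2.2 * h ^ q'.2.2.2 := by
                rw [← pow_add, ← pow_add, hσ, hσ']
              linear_combination (q.1.2.1 * q.2.2.1 * q'.1.2.1 * q'.2.2.1 * x ^ 2 : ZMod p) * this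
            rw [mem_coe, mem_product]
            constructor
            · have hd : q.1.1 ∣ q'.1.1 * q'.2.1 * (q.1.2.1 * q.2.2.1) :=
                hprod ▸ Dvd.intro _ (by ring : q.1.1 * (q.2.1 * (q'.1.2.1 * q'.2.2.1)) = _)
              rw [g1.1.1.dvd_mul, g1.1.1.dvd_mul, g1.1.1.dvd_mul,
                Nat.prime_dvd_prime_iff_eq g1.1.1 g1'.1.1, Nat.prime_dvd_prime_iff_eq g1.1.1 g2'.1.1,
                Nat.prime_dvd_prime_iff_eq g1.1.1 g1.2.1.1, Nat.prime_dvd_prime_iff_eq g1.1.1 g2.2.1.1] at hd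
              simp only [mem_insert, mem_singleton]
              rcases hd with hd | hd | hd
              · exact hd
              · exact absurd (hd ▸ g1.1.2.2) g1.2.1.2.2
              · exact absurd (hd ▸ g1.1.2.2) g2.2.1.2.2
            · have hd : q.1.2.1 ∣ q.1.1 * q.2.1 * (q'.1.2.1 * q'.2.2.1) :=
                hprod ▸ Dvd.intro _ (by ring : q.1.2.1 * (q'.1.1 * q'.2.1 * q.2.2.1) = _)
              have pr := g1.2.1.1
              rw [pr.dvd_mul, pr.dvd_mul, pr.dvd_mul,
                Nat.prime_dvd_prime_iff_eq pr g1.1.1, Nat.prime_dvd_prime_iff_eq pr g2.1.1,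
                Nat.prime_dvd_prime_iff_eq pr g1'.2.1.1, Nat.prime_dvd_prime_iff_eq pr g2'.2.1.1] at hd
              simp only [mem_insert, mem_singleton]
              rcases hd with (hd | hd) | hd
              · exact absurd (hd ▸ g1.1.2.2) g1.2.1.2.2
              · exact absurd (hd ▸ g2.1.2.2) g1.2.1.2.2
              · exact hd
          · intro q hq r hr hqr
            obtain ⟨hq1, hσ⟩ := mem_filter.1 (mem_coe.1 hq)
            obtain ⟨m1, m2⟩ := mem_product.1 hq1
            obtain ⟨hr1, hτ⟩ := mem_filter.1 (mem_coe.1 hr)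
            obtain ⟨n1, n2⟩ := mem_product.1 hr1
            have g1 := hE _ m1
            have g2 := hE _ m2
            have k1 := hE _ n1
            have k2 := hE _ n2
            obtain ⟨⟨a1, b1, j1⟩, ⟨a2, b2, j2⟩⟩ := q
            obtain ⟨⟨a1s, b1s, j1s⟩, ⟨a2s, b2s, j2s⟩⟩ := r
            simp only [Prod.mk.injEq] at hqr hσ hτ g1 g2 k1 k2 ⊢
            obtain ⟨rfl, rfl⟩ := hqr
            have hK1 : 1 ≤ K := g1.1.1.one_le.trans g1.1.2.1
            have hbne : (b1 : ZMod p) ≠ 0 := by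
              intro h0
              have h5 := nat_of_zmod (m := b1) (n := 0)
                (by have := two_lt hK hK1 g1.2.1.2.1 hK1; simpa using this) (Fact.out : p.Prime).pos
                (by simpa using h0)
              exact g1.2.1.1.ne_zero h5
            have hj : j1 = j1s := by
              have e : (b1 : ZMod p) * h ^ j1 * x = b1 * h ^ j1s * x := g1.2.2.2.symm.trans k1.2.2.2
              have e' := mul_left_cancel₀ hbne (mul_right_cancel₀ hx e)
              exact hinj (Set.mem_Iic.2 (by omega)) (Set.mem_Iic.2 (by omega)) e'
            subst hj
            have hj2 : j2 = j2s := by omega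
            subst hj2
            have hr := prime_ratio (p := p) (two_lt hK hK1 g2.1.2.1 k2.2.1.2.1)
              (two_lt hK hK1 k2.1.2.1 g2.2.1.2.1) g2.1.1 g2.2.1.1 k2.1.1
              (fun hab => g2.2.1.2.2 (hab ▸ g2.1.2.2))
              (by rw [g2.2.2.2, k2.2.2.2]; ring)
            obtain ⟨rfl, rfl⟩ := hr
            simp
      _ ≤ 2 * 2 := by
          rw [card_product]
          exact Nat.mul_le_mul card_le_two card_le_two
      _ = 4 := rfl
  calc _ ≤ ∑ σ ∈ range (2 * N), 4 := sum_le_sum hfib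
    _ = 8 * N := by simp; ring

/-- solutions for fixed ratio -/
def Rx {p : ℕ} (h : ZMod p) (N K : ℕ) (x : ZMod p) : Finset (ℕ × ℕ × ℕ) :=
  (PP K ×ˢ (PP K ×ˢ range N)).filter
    (fun e => e.1 ≠ e.2.1 ∧ (e.1 : ZMod p) = e.2.1 * h ^ e.2.2 * x)

theorem rho_bound {p : ℕ} [Fact p.Prime] (h : ZMod p) (hh : h ≠ 0) (N K : ℕ) (hK : K ^ 4 < p)
    (hinj : Set.InjOn (fun y : ℕ => h ^ y) (Set.Iic N)) (x : ZMod p) (hx : x ≠ 0) :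
    ((Rx h N K x).card : ℝ) ≤ (Nat.log 2 K + 1) * (2 * Real.sqrt (8 * N)) := by
  classical
  set ℓ := Nat.log 2 K + 1 with hℓ
  let F : ℕ → Bool → Finset (ℕ × ℕ × ℕ) := fun i s =>
    (Rx h N K x).filter (fun e => e.1.testBit i = s ∧ ¬ e.2.1.testBit i = s)
  have hF : ∀ i s, ((F i s).card : ℝ) ≤ Real.sqrt (8 * N) := by
    intro i s
    apply Real.le_sqrt_of_sq_le
    have := rho_bip h hh N K hK hinj x hx (fun a => a.testBit i = s) (F i s) (by
      intro e he
      obtain ⟨he1, hc1, hc2⟩ := mem_filter.1 he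
      obtain ⟨he2, hne, heq⟩ := mem_filter.1 he1
      obtain ⟨ha, hbj⟩ := mem_product.1 he2
      obtain ⟨hb, hj⟩ := mem_product.1 hbj
      simp only [PP, mem_filter, mem_Icc] at ha hb
      exact ⟨⟨ha.2, ha.1.2, hc1⟩, ⟨hb.2, hb.1.2, hc2⟩, mem_range.1 hj, heq⟩)
    exact_mod_cast this
  have hcov : Rx h N K x ⊆ (range ℓ).biUnion (fun i => F i true ∪ F i false) := by
    intro e he
    obtain ⟨he2, hne, heq⟩ := mem_filter.1 he
    obtain ⟨ha, hbj⟩ := mem_product.1 he2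
    obtain ⟨hb, hj⟩ := mem_product.1 hbj
    simp only [PP, mem_filter, mem_Icc] at ha hb
    obtain ⟨i, hi⟩ : ∃ i, e.1.testBit i ≠ e.2.1.testBit i := by
      by_contra hc
      push Not at hc
      exact hne (Nat.eq_of_testBit_eq hc)
    have hiℓ : i < ℓ := by
      by_contra hc
      have hKl : K < 2 ^ ℓ := Nat.lt_pow_succ_log_self (by norm_num) K
      have hle : 2 ^ ℓ ≤ 2 ^ i := Nat.pow_le_pow_right (by norm_num) (by omega)
      rw [Nat.testBit_lt_two_pow (by omega), Nat.testBit_lt_two_pow (by omega)] at hi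
      exact hi rfl
    rw [mem_biUnion]
    refine ⟨i, mem_range.2 hiℓ, ?_⟩
    simp only [F, mem_union, mem_filter, he, true_and]
    cases h1 : e.1.testBit i <;> cases h2 : e.2.1.testBit i <;> simp_all
  have h1 : (Rx h N K x).card ≤ ∑ i ∈ range ℓ, ((F i true).card + (F i false).card) :=
    (card_le_card hcov).trans (card_biUnion_le.trans (sum_le_sum fun i _ => card_union_le _ _))
  calc ((Rx h N K x).card : ℝ) ≤ ∑ i ∈ range ℓ, (((F i true).card : ℝ) + (F i false).card) := by
        exact_mod_cast h1
    _ ≤ ∑ i ∈ range ℓ, (2 * Real.sqrt (8 * N)) := by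
        refine sum_le_sum fun i _ => ?_
        linarith [hF i true, hF i false]
    _ = _ := by rw [sum_const, card_range, nsmul_eq_mul, hℓ]; push_cast; ring


/-- index set of triples -/
def I3 (N K : ℕ) : Finset (ℕ × ℕ × ℕ) := PP K ×ˢ (Icc 1 N ×ˢ Icc 1 N)

/-- value of a triple -/
def f3 {p : ℕ} (h : ZMod p) (i : ℕ × ℕ × ℕ) : ZMod p := (i.1 : ZMod p) * (h ^ i.2.1 + h ^ i.2.2)

theorem PP_ne {p : ℕ} {K a : ℕ} (hK : K < p) (ha : a ∈ PP K) : (a : ZMod p) ≠ 0 := by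
  intro h0
  simp only [PP, mem_filter, mem_Icc] at ha
  have := nat_of_zmod (p := p) (m := a) (n := 0) (by omega) (by omega) (by simpa using h0)
  omega

theorem J_bound {p : ℕ} [Fact p.Prime] (h : ZMod p) (hh : h ≠ 0) (N K : ℕ) (hK : K < p)
    (hinj : Set.InjOn (fun y : ℕ => h ^ y) (Set.Iic N)) (ρ : ℕ)
    (hρ : ∀ x : ZMod p, x ≠ 0 → (Rx h N K x).card ≤ ρ) (hN : 1 ≤ N) :
    ((I3 N K ×ˢ I3 N K).filter (fun q => f3 h q.1 = f3 h q.2)).card ≤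
      (PP K).card * T2 h N + (PP K).card ^ 2 * N ^ 2 + 4 * N ^ 3 * ρ := by
  classical
  set J := (I3 N K ×ˢ I3 N K).filter (fun q => f3 h q.1 = f3 h q.2) with hJ
  have hmem : ∀ q ∈ J, q.1.1 ∈ PP K ∧ q.1.2.1 ∈ Icc 1 N ∧ q.1.2.2 ∈ Icc 1 N ∧ q.2.1 ∈ PP K ∧
      q.2.2.1 ∈ Icc 1 N ∧ q.2.2.2 ∈ Icc 1 N ∧
      (q.1.1 : ZMod p) * (h ^ q.1.2.1 + h ^ q.1.2.2) = q.2.1 * (h ^ q.2.2.1 + h ^ q.2.2.2) := by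
    intro q hq
    rw [hJ, mem_filter] at hq
    simp only [I3, f3, mem_product] at hq
    tauto
  clear_value J
  have hsplit : J ⊆ J.filter (fun q => q.1.1 = q.2.1) ∪
      J.filter (fun q => h ^ q.1.2.1 + h ^ q.1.2.2 = 0) ∪
      J.filter (fun q => q.1.1 ≠ q.2.1 ∧ h ^ q.1.2.1 + h ^ q.1.2.2 ≠ 0) := by
    intro q hq
    simp only [mem_union, mem_filter, hq, true_and]
    tauto
  have h1 : (J.filter (fun q => q.1.1 = q.2.1)).card ≤ (PP K).card * T2 h N := by
    rw [T2, ← card_product]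
    refine card_le_card_of_injOn (fun q => (q.1.1, (q.1.2, q.2.2))) ?_ ?_
    · intro q hq
      obtain ⟨hq1, hq2⟩ := mem_filter.1 (mem_coe.1 hq)
      obtain ⟨a1, a2, a3, a4, a5, a6, a7⟩ := hmem q hq1
      rw [← hq2] at a7
      have := mul_left_cancel₀ (PP_ne hK a1) a7
      simp only [mem_coe, mem_product, mem_filter]
      exact ⟨a1, ⟨⟨a2, a3⟩, a5, a6⟩, this⟩
    · intro q hq r hr hqr
      obtain ⟨hq1, hq2⟩ := mem_filter.1 (mem_coe.1 hq)
      obtain ⟨hr1, hr2⟩ := mem_filter.1 (mem_coe.1 hr)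
      simp only [Prod.mk.injEq] at hqr
      obtain ⟨e1, e2, e3⟩ := hqr
      exact Prod.ext (Prod.ext e1 e2) (Prod.ext (hq2.symm.trans (e1.trans hr2)) e3)
  have hneg : ∀ a b c : ℕ, b ∈ Icc 1 N → c ∈ Icc 1 N → h ^ a + h ^ b = 0 → h ^ a + h ^ c = 0 →
      b = c := by
    intro a b c hb hc e1 e2
    rw [mem_Icc] at hb hc
    exact hinj (Set.mem_Iic.2 hb.2) (Set.mem_Iic.2 hc.2) (by
      simp only
      linear_combination e1 - e2)
  have h2 : (J.filter (fun q => h ^ q.1.2.1 + h ^ q.1.2.2 = 0)).card ≤ (PP K).card ^ 2 * N ^ 2 := by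
    have : (PP K).card ^ 2 * N ^ 2 = ((PP K ×ˢ PP K) ×ˢ (Icc 1 N ×ˢ Icc 1 N)).card := by
      simp only [card_product, Nat.card_Icc]; simp; ring
    rw [this]
    refine card_le_card_of_injOn (fun q => ((q.1.1, q.2.1), (q.1.2.1, q.2.2.1))) ?_ ?_
    · intro q hq
      obtain ⟨hq1, hq2⟩ := mem_filter.1 (mem_coe.1 hq)
      obtain ⟨a1, a2, a3, a4, a5, a6, a7⟩ := hmem q hq1
      simp only [mem_coe, mem_product]
      exact ⟨⟨a1, a4⟩, a2, a5⟩
    · intro q hq r hr hqr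
      obtain ⟨hq1, hq2⟩ := mem_filter.1 (mem_coe.1 hq)
      obtain ⟨hr1, hr2⟩ := mem_filter.1 (mem_coe.1 hr)
      obtain ⟨a1, a2, a3, a4, a5, a6, a7⟩ := hmem q hq1
      obtain ⟨b1, b2, b3, b4, b5, b6, b7⟩ := hmem r hr1
      rw [hq2, mul_zero] at a7
      rw [hr2, mul_zero] at b7
      have a8 := (mul_eq_zero.1 a7.symm).resolve_left (PP_ne hK a4)
      have b8 := (mul_eq_zero.1 b7.symm).resolve_left (PP_ne hK b4)
      simp only [Prod.mk.injEq] at hqr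
      obtain ⟨⟨e1, e2⟩, e3, e4⟩ := hqr
      rw [← e3] at hr2
      rw [← e4] at b8
      exact Prod.ext (Prod.ext e1 (Prod.ext e3 (hneg _ _ _ a3 b3 hq2 hr2)))
        (Prod.ext e2 (Prod.ext e4 (hneg _ _ _ a6 b6 a8 b8)))
  have h3 : (J.filter (fun q => q.1.1 ≠ q.2.1 ∧ h ^ q.1.2.1 + h ^ q.1.2.2 ≠ 0)).card ≤
      4 * N ^ 3 * ρ := by
    set J' := J.filter (fun q => q.1.1 ≠ q.2.1 ∧ h ^ q.1.2.1 + h ^ q.1.2.2 ≠ 0) with hJ'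
    have key : (J' ×ˢ range N).card ≤
        ρ * ((Icc 1 (2 * N) ×ˢ Icc 1 (2 * N)) ×ˢ (Icc 1 N ×ˢ Icc 1 N)).card := by
      refine card_le_mul_card_image_of_maps_to
        (f := fun w => ((w.1.1.2.1 + w.2, w.1.1.2.2 + w.2), (w.1.2.2.1, w.1.2.2.2))) ?_ ρ ?_
      · intro w hw
        obtain ⟨w1, w2⟩ := mem_product.1 hw
        obtain ⟨w3, w4⟩ := mem_filter.1 w1
        obtain ⟨a1, a2, a3, a4, a5, a6, a7⟩ := hmem _ w3
        simp only [mem_coe, mem_product]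
        rw [mem_range] at w2
        refine ⟨⟨?_, ?_⟩, a5, a6⟩
        · rw [mem_Icc] at *; omega
        · rw [mem_Icc] at *; omega
      · intro b _
        set Fb := (J' ×ˢ range N).filter (fun w =>
          ((w.1.1.2.1 + w.2, w.1.1.2.2 + w.2), (w.1.2.2.1, w.1.2.2.2)) = b) with hFb
        rcases Fb.eq_empty_or_nonempty with h0 | ⟨w0, hw0⟩
        · rw [h0]; simp
        have hprop : ∀ w ∈ Fb, w.1.1.1 ∈ PP K ∧ w.1.2.1 ∈ PP K ∧ w.2 < N ∧ w.1.1.1 ≠ w.1.2.1 ∧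
            h ^ b.1.1 + h ^ b.1.2 ≠ 0 ∧ h ^ b.2.1 + h ^ b.2.2 ≠ 0 ∧
            (w.1.1.1 : ZMod p) = w.1.2.1 * h ^ w.2 *
              ((h ^ b.2.1 + h ^ b.2.2) / (h ^ b.1.1 + h ^ b.1.2)) := by
          intro w hw
          obtain ⟨hw1, hw2⟩ := mem_filter.1 hw
          obtain ⟨w1, w2⟩ := mem_product.1 hw1
          obtain ⟨w3, w4, w5⟩ := mem_filter.1 w1
          obtain ⟨a1, a2, a3, a4, a5, a6, a7⟩ := hmem _ w3
          subst hw2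
          have hu : h ^ (w.1.1.2.1 + w.2) + h ^ (w.1.1.2.2 + w.2) =
            h ^ w.2 * (h ^ w.1.1.2.1 + h ^ w.1.1.2.2) := by ring
          have hu0 : h ^ (w.1.1.2.1 + w.2) + h ^ (w.1.1.2.2 + w.2) ≠ 0 := by
            rw [hu]; exact mul_ne_zero (pow_ne_zero _ hh) w5
          refine ⟨a1, a4, mem_range.1 w2, w4, hu0, ?_, ?_⟩
          · intro h0
            simp only at h0
            rw [h0, mul_zero] at a7
            exact (mul_ne_zero (PP_ne hK a1) w5) a7
          · simp only
            rw [← mul_div_assoc, eq_div_iff hu0, hu]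
            linear_combination h ^ w.2 * a7
        have p0 := hprop w0 hw0
        refine le_trans ?_ (hρ ((h ^ b.2.1 + h ^ b.2.2) / (h ^ b.1.1 + h ^ b.1.2))
          (div_ne_zero p0.2.2.2.2.2.1 p0.2.2.2.2.1))
        refine card_le_card_of_injOn (fun w => (w.1.1.1, w.1.2.1, w.2)) ?_ ?_
        · intro w hw
          obtain ⟨a1, a2, a3, a4, a5, a6, a7⟩ := hprop w (mem_coe.1 hw)
          simp only [Rx, mem_coe, mem_filter, mem_product, mem_range]
          exact ⟨⟨a1, a2, a3⟩, a4, a7⟩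
        · intro w hw r hr hwr
          obtain ⟨_, hw2⟩ := mem_filter.1 (mem_coe.1 hw)
          obtain ⟨_, hr2⟩ := mem_filter.1 (mem_coe.1 hr)
          have e := hw2.trans hr2.symm
          obtain ⟨⟨⟨a, y1, y2⟩, ⟨b', y3, y4⟩⟩, j⟩ := w
          obtain ⟨⟨⟨a', y1', y2'⟩, ⟨b'', y3', y4'⟩⟩, j'⟩ := r
          simp only [Prod.mk.injEq] at e hwr ⊢
          omega
    have e1 : (J' ×ˢ range N).card = J'.card * N := by simp
    have e2 : ((Icc 1 (2 * N) ×ˢ Icc 1 (2 * N)) ×ˢ (Icc 1 N ×ˢ Icc 1 N)).card = 4 * N ^ 3 * N := by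
      simp; ring
    rw [e1, e2] at key
    refine Nat.le_of_mul_le_mul_right (key.trans (le_of_eq ?_)) hN
    ring
  calc J.card ≤ _ := card_le_card hsplit
    _ ≤ _ := (card_union_le _ _).trans (Nat.add_le_add_right (card_union_le _ _) _)
    _ ≤ _ := by omega


/-- the set of the statement -/
def XX {p : ℕ} (h : ZMod p) (N : ℕ) : Finset (ZMod p) :=
  (Icc 1 N ×ˢ ((Icc 1 N ×ˢ Icc 1 N) ×ˢ (Icc 1 N ×ˢ Icc 1 N))).image
    (fun q => (q.1 : ZMod p) * (h ^ q.2.1.1 + h ^ q.2.1.2 + h ^ q.2.2.1 + h ^ q.2.2.2))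

theorem image_le_XX {p : ℕ} [Fact p.Prime] (hp2 : 2 < p) (h : ZMod p) (N K : ℕ) (hKN : K ≤ N) :
    ((I3 N K).image (f3 h)).card ≤ (XX h N).card := by
  classical
  have h2 : (2 : ZMod p) ≠ 0 := by
    intro h0
    have := nat_of_zmod (p := p) (m := 2) (n := 0) hp2 (by omega) (by simpa using h0)
    omega
  refine card_le_card_of_injOn (fun z => 2 * z) ?_ ?_
  · intro z hz
    obtain ⟨i, hi, rfl⟩ := mem_image.1 (mem_coe.1 hz)
    simp only [I3, PP, mem_product, mem_filter, mem_Icc] at hi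
    rw [mem_coe, XX, mem_image]
    refine ⟨(i.1, ((i.2.1, i.2.1), (i.2.2, i.2.2))), ?_, ?_⟩
    · simp only [mem_product, mem_Icc]; omega
    · simp only [f3]; ring
  · intro a _ b _ hab
    exact mul_left_cancel₀ h2 hab

set_option maxHeartbeats 1000000 in
theorem regA (δ : ℝ) (hδ0 : 0 < δ) (hδ1 : δ ≤ 1 / 40) : ∃ N1 : ℕ, ∀ (p : ℕ) [Fact p.Prime]
    (h : ZMod p) (N : ℕ), 2 < p → h ≠ 0 → N1 ≤ N → (N : ℝ) ^ 2 ≤ p →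
    Set.InjOn (fun y : ℕ => h ^ y) (Set.Iic N) → (T2 h N : ℝ) ≤ (N : ℝ) ^ (3 - 2 * δ) →
    (⌊(N : ℝ) ^ (1 - δ)⌋₊) ^ 4 < p → (N : ℝ) ^ 2 ≤ 3 * (XX h N).card := by
  obtain ⟨M0, hM0⟩ := prime_count (δ / 2) (by positivity)
  obtain ⟨M1, hM1⟩ := pow_large (1 / 2) (by norm_num) M0
  obtain ⟨M2, hM2⟩ := pow_large (δ / 2) (by positivity) 2
  obtain ⟨M3, hM3⟩ := log_small (1 / 20) (by norm_num) (1 / 4) (by norm_num)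
  obtain ⟨M4, hM4⟩ := pow_large (1 / 20) (by norm_num) 2
  obtain ⟨M5, hM5⟩ := pow_large (35 / 100) (by norm_num) 24
  refine ⟨max (max (max M1 M2) (max M3 M4)) (max M5 2), ?_⟩
  intro p _ h N hp2 hh hN hNp hinj hT hKp
  have b1 := hM1 N (by omega)
  have b2 := hM2 N (by omega)
  have b3 := hM3 N (by omega)
  have b4 := hM4 N (by omega)
  have b5 := hM5 N (by omega)
  have hN2 : 2 ≤ N := by omega
  have hNR : (2 : ℝ) ≤ N := by exact_mod_cast hN2
  have hN1 : (1 : ℝ) ≤ N := by linarith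
  have hN0 : (0 : ℝ) < N := by linarith
  set K := ⌊(N : ℝ) ^ (1 - δ)⌋₊ with hKdef
  have hKle : (K : ℝ) ≤ (N : ℝ) ^ (1 - δ) := Nat.floor_le (by positivity)
  have hKN : K ≤ N := by
    have : (K : ℝ) ≤ N := hKle.trans
      ((Real.rpow_le_rpow_of_exponent_le hN1 (by linarith : 1 - δ ≤ 1)).trans_eq (Real.rpow_one _))
    exact_mod_cast this
  have hKge : (N : ℝ) ^ (1 - 3 * δ / 2) ≤ K := by
    have e1 : (N : ℝ) ^ (1 - δ) = (N : ℝ) ^ (1 - 3 * δ / 2) * (N : ℝ) ^ (δ / 2) := by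
      rw [← Real.rpow_add hN0]; congr 1; ring
    have e2 : (N : ℝ) ^ (1 - δ) < K + 1 := Nat.lt_floor_add_one _
    have e3 : (1 : ℝ) ≤ (N : ℝ) ^ (1 - 3 * δ / 2) := Real.one_le_rpow hN1 (by linarith)
    nlinarith
  have hKM : M0 ≤ K := by
    have : (M0 : ℝ) ≤ K := b1.trans (le_trans
      (Real.rpow_le_rpow_of_exponent_le hN1 (by linarith)) hKge)
    exact_mod_cast this
  have hk0 := hM0 K hKM
  set k : ℝ := ((PP K).card : ℝ) with hk
  have hk1 : (N : ℝ) ^ (1 - 2 * δ) ≤ k := by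
    refine le_trans ?_ hk0
    calc (N : ℝ) ^ (1 - 2 * δ) ≤ (N : ℝ) ^ ((1 - 3 * δ / 2) * (1 - δ / 2)) :=
          Real.rpow_le_rpow_of_exponent_le hN1 (by nlinarith)
      _ = ((N : ℝ) ^ (1 - 3 * δ / 2)) ^ (1 - δ / 2) := Real.rpow_mul hN0.le _ _
      _ ≤ _ := Real.rpow_le_rpow (by positivity) hKge (by linarith)
  have hkpos : 0 < k := lt_of_lt_of_le (by positivity) hk1
  have hKp' : K < p := by
    rcases Nat.eq_zero_or_pos K with h0 | h0
    · rw [h0]; omega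
    · exact lt_of_le_of_lt (Nat.le_self_pow (by norm_num) K) hKp
  set R : ℝ := (Nat.log 2 K + 1) * (2 * Real.sqrt (8 * N)) with hR
  have hR0 : 0 ≤ R := by positivity
  have hJ := J_bound h hh N K hKp' hinj ⌊R⌋₊
    (fun x hx => Nat.le_floor (rho_bound h hh N K hKp hinj x hx)) (by omega)
  have hρ : (⌊R⌋₊ : ℝ) ≤ R := Nat.floor_le hR0
  have hlog : (Nat.log 2 K : ℝ) ≤ 2 * Real.log N := by
    calc (Nat.log 2 K : ℝ) ≤ Nat.log 2 N := by exact_mod_cast Nat.log_mono_right hKN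
      _ ≤ Real.logb 2 N := by exact_mod_cast Real.natLog_le_logb N 2
      _ = Real.log N / Real.log 2 := rfl
      _ ≤ 2 * Real.log N := by
        have := Real.log_two_gt_d9
        have hl : 0 ≤ Real.log N := Real.log_nonneg hN1
        rw [div_le_iff₀ (by linarith)]
        nlinarith
  have hR1 : R ≤ 6 * (N : ℝ) ^ (55 / 100 : ℝ) := by
    have s1 : Real.sqrt (8 * N) ≤ 3 * (N : ℝ) ^ (1 / 2 : ℝ) := by
      rw [Real.sqrt_le_left (by positivity), mul_pow, ← Real.sqrt_eq_rpow, Real.sq_sqrt hN0.le]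
      nlinarith
    have s2 : (Nat.log 2 K : ℝ) + 1 ≤ (N : ℝ) ^ (1 / 20 : ℝ) := by linarith
    calc R ≤ (N : ℝ) ^ (1 / 20 : ℝ) * (2 * (3 * (N : ℝ) ^ (1 / 2 : ℝ))) := by rw [hR]; gcongr
      _ = 6 * ((N : ℝ) ^ (1 / 20 : ℝ) * (N : ℝ) ^ (1 / 2 : ℝ)) := by ring
      _ = _ := by rw [← Real.rpow_add hN0]; norm_num
  have hk2 : (N : ℝ) ^ (19 / 10 : ℝ) ≤ k ^ 2 := by
    calc (N : ℝ) ^ (19 / 10 : ℝ) ≤ (N : ℝ) ^ ((1 - 2 * δ) * 2) :=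
          Real.rpow_le_rpow_of_exponent_le hN1 (by linarith)
      _ = ((N : ℝ) ^ (1 - 2 * δ)) ^ 2 := by rw [Real.rpow_mul hN0.le]; norm_num
      _ ≤ _ := by gcongr
  have hρ2 : 4 * N * (⌊R⌋₊ : ℝ) ≤ k ^ 2 := by
    calc 4 * N * (⌊R⌋₊ : ℝ) ≤ 4 * N * (6 * (N : ℝ) ^ (55 / 100 : ℝ)) := by gcongr; linarith
      _ = 24 * ((N : ℝ) ^ (1 : ℝ) * (N : ℝ) ^ (55 / 100 : ℝ)) := by rw [Real.rpow_one]; ring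
      _ = 24 * (N : ℝ) ^ (155 / 100 : ℝ) := by rw [← Real.rpow_add hN0]; norm_num
      _ ≤ (N : ℝ) ^ (35 / 100 : ℝ) * (N : ℝ) ^ (155 / 100 : ℝ) := by gcongr
      _ = (N : ℝ) ^ (19 / 10 : ℝ) := by rw [← Real.rpow_add hN0]; norm_num
      _ ≤ _ := hk2
  have hT2 : (T2 h N : ℝ) ≤ N ^ 2 * k := by
    calc (T2 h N : ℝ) ≤ (N : ℝ) ^ (3 - 2 * δ) := hT
      _ = (N : ℝ) ^ (2 : ℝ) * (N : ℝ) ^ (1 - 2 * δ) := by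
          rw [← Real.rpow_add hN0]; congr 1; ring
      _ = (N : ℝ) ^ 2 * (N : ℝ) ^ (1 - 2 * δ) := by norm_num
      _ ≤ _ := by gcongr
  set J := ((I3 N K ×ˢ I3 N K).filter (fun q => f3 h q.1 = f3 h q.2)).card with hJd
  have hJR : (J : ℝ) ≤ k * T2 h N + k ^ 2 * N ^ 2 + 4 * N ^ 3 * (⌊R⌋₊ : ℝ) := by
    rw [hk]
    exact_mod_cast hJ
  have hJ3 : (J : ℝ) ≤ 3 * k ^ 2 * N ^ 2 := by
    have c1 : k * T2 h N ≤ k * (N ^ 2 * k) := by gcongr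
    have c2 : 4 * N ^ 3 * (⌊R⌋₊ : ℝ) ≤ N ^ 2 * k ^ 2 := by
      calc 4 * N ^ 3 * (⌊R⌋₊ : ℝ) = N ^ 2 * (4 * N * (⌊R⌋₊ : ℝ)) := by ring
        _ ≤ _ := by gcongr
    nlinarith
  have hcs := cs_fiber (I3 N K) (f3 h)
  rw [← hJd] at hcs
  have hI : ((I3 N K).card : ℝ) = k * N ^ 2 := by
    rw [I3, card_product, card_product, Nat.card_Icc, Nat.add_sub_cancel, hk]
    push_cast
    ring
  rw [hI] at hcs
  have him : (((I3 N K).image (f3 h)).card : ℝ) ≤ (XX h N).card := by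
    exact_mod_cast image_le_XX hp2 h N K hKN
  have hfin : (k ^ 2 * N ^ 2) * (N : ℝ) ^ 2 ≤ (k ^ 2 * N ^ 2) * (3 * (XX h N).card) := by
    calc (k ^ 2 * N ^ 2) * (N : ℝ) ^ 2 = (k * N ^ 2) ^ 2 := by ring
      _ ≤ _ := hcs
      _ ≤ (XX h N).card * (3 * k ^ 2 * N ^ 2) := by gcongr
      _ = _ := by ring
  exact le_of_mul_le_mul_left hfin (by positivity)


theorem sq_lt_of_prime {p N : ℕ} (hp : p.Prime) (h : N ^ 2 ≤ p) : N ^ 2 < p := by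
  refine lt_of_le_of_ne h ?_
  intro h0
  rw [← h0] at hp
  exact Nat.Prime.not_prime_pow (le_refl 2) hp

theorem kappa_aux {p : ℕ} [Fact p.Prime] (h : ZMod p) (hh : h ≠ 0) (N M : ℕ) (hN : N ^ 2 ≤ p)
    (hMN : M ≤ N) (hinj : Set.InjOn (fun y : ℕ => h ^ y) (Set.Iic N)) (t : ZMod p) (ht : t ≠ 0)
    (A : Finset ℕ) (hA : A ⊆ PP N) (S : Finset (ZMod p))
    (hS : ∀ a ∈ A, ∀ j < M, h ^ j * (a * t) ∈ S) :
    ((A.card : ℝ) * M) ^ 2 ≤ S.card * (A.card * M + M ^ 2) := by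
  classical
  have hlt := sq_lt_of_prime (Fact.out : p.Prime) hN
  have hNp : N < p := lt_of_le_of_lt (Nat.le_self_pow (by norm_num) N) hlt
  have hcs := cs_fiber (A ×ˢ range M) (fun w => h ^ w.2 * ((w.1 : ZMod p) * t))
  set C := (((A ×ˢ range M) ×ˢ (A ×ˢ range M)).filter
    (fun q => h ^ q.1.2 * ((q.1.1 : ZMod p) * t) = h ^ q.2.2 * ((q.2.1 : ZMod p) * t))) with hC
  have hmem : ∀ q ∈ C, q.1.1 ∈ PP N ∧ q.2.1 ∈ PP N ∧ q.1.1 ∈ A ∧ q.1.2 < M ∧ q.2.2 < M ∧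
      h ^ q.1.2 * (q.1.1 : ZMod p) = h ^ q.2.2 * (q.2.1 : ZMod p) := by
    intro q hq
    rw [hC, mem_filter] at hq
    obtain ⟨h1, h2⟩ := hq
    simp only [mem_product, mem_range] at h1
    refine ⟨hA h1.1.1, hA h1.2.1, h1.1.1, h1.1.2, h1.2.2, ?_⟩
    apply mul_right_cancel₀ ht
    linear_combination h2
  have hCc : C.card ≤ A.card * M + M ^ 2 := by
    have h1 : (C.filter (fun q => q.1.1 = q.2.1)).card ≤ A.card * M := by
      have : A.card * M = (A ×ˢ range M).card := by simp
      rw [this]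
      refine card_le_card_of_injOn (fun q => q.1) ?_ ?_
      · intro q hq
        obtain ⟨hq1, hq2⟩ := mem_filter.1 (mem_coe.1 hq)
        obtain ⟨a1, a2, a3, a4, a5, a6⟩ := hmem q hq1
        simp only [mem_coe, mem_product, mem_range]
        exact ⟨a3, a4⟩
      · intro q hq r hr hqr
        obtain ⟨hq1, hq2⟩ := mem_filter.1 (mem_coe.1 hq)
        obtain ⟨a1, a2, a3, a4, a5, a6⟩ := hmem q hq1
        obtain ⟨hr1, hr2⟩ := mem_filter.1 (mem_coe.1 hr)
        obtain ⟨b1, b2, b3, b4, b5, b6⟩ := hmem r hr1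
        rw [← hq2] at a6
        rw [← hr2] at b6
        have a7 := hinj (Set.mem_Iic.2 (by omega)) (Set.mem_Iic.2 (by omega))
          (mul_right_cancel₀ (PP_ne hNp a1) a6)
        have b7 := hinj (Set.mem_Iic.2 (by omega)) (Set.mem_Iic.2 (by omega))
          (mul_right_cancel₀ (PP_ne hNp b1) b6)
        simp only at hqr
        refine Prod.ext hqr (Prod.ext ?_ ?_)
        · rw [← hq2, ← hr2, hqr]
        · rw [← a7, ← b7, hqr]
    have h2 : (C.filter (fun q => ¬ q.1.1 = q.2.1)).card ≤ M ^ 2 := by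
      have : M ^ 2 = (range M ×ˢ range M).card := by simp; ring
      rw [this]
      refine card_le_card_of_injOn (fun q => (q.1.2, q.2.2)) ?_ ?_
      · intro q hq
        obtain ⟨hq1, hq2⟩ := mem_filter.1 (mem_coe.1 hq)
        obtain ⟨a1, a2, a3, a4, a5, a6⟩ := hmem q hq1
        simp only [mem_coe, mem_product, mem_range]
        exact ⟨a4, a5⟩
      · intro q hq r hr hqr
        obtain ⟨hq1, hq2⟩ := mem_filter.1 (mem_coe.1 hq)
        obtain ⟨a1, a2, a3, a4, a5, a6⟩ := hmem q hq1
        obtain ⟨hr1, hr2⟩ := mem_filter.1 (mem_coe.1 hr)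
        obtain ⟨b1, b2, b3, b4, b5, b6⟩ := hmem r hr1
        simp only [Prod.mk.injEq] at hqr
        obtain ⟨e1, e2⟩ := hqr
        simp only [PP, mem_filter, mem_Icc] at a1 a2 b1 b2
        have hr := prime_ratio (p := p) (a := q.1.1) (b := q.2.1) (a' := r.1.1) (b' := r.2.1)
          (lt_of_le_of_lt (by nlinarith) hlt) (lt_of_le_of_lt (by nlinarith) hlt)
          a1.2 a2.2 b1.2 hq2 (by
            have hj : h ^ (q.1.2 + q.2.2) ≠ 0 := pow_ne_zero _ hh
            apply mul_left_cancel₀ hj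
            rw [pow_add]
            rw [← e1, ← e2] at b6
            linear_combination (h ^ q.2.2 * r.2.1) * a6 - (h ^ q.2.2 * q.2.1) * b6)
        exact Prod.ext (Prod.ext hr.1 e1) (Prod.ext hr.2 e2)
    rw [← card_filter_add_card_filter_not (s := C) (fun q => q.1.1 = q.2.1)]
    exact Nat.add_le_add h1 h2
  have him : ((A ×ˢ range M).image (fun w => h ^ w.2 * ((w.1 : ZMod p) * t))).card ≤ S.card := by
    refine card_le_card ?_
    intro z hz
    obtain ⟨w, hw, rfl⟩ := mem_image.1 hz
    simp only [mem_product, mem_range] at hw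
    exact hS _ hw.1 _ hw.2
  have e : ((A ×ˢ range M).card : ℝ) = A.card * M := by simp
  rw [e] at hcs
  refine hcs.trans ?_
  have : (C.card : ℝ) ≤ A.card * M + M ^ 2 := by exact_mod_cast hCc
  gcongr

theorem kappa_bound {A M S : ℝ} (hA : 0 ≤ A) (hM : 0 < M) (hS : 0 ≤ S)
    (h : (A * M) ^ 2 ≤ S * (A * M + M ^ 2)) (κ : ℝ) (hκ : 0 ≤ κ) (hκM : κ ≤ M) (hSκ : 2 * S < κ ^ 2) :
    A ≤ κ := by
  by_contra hc
  push Not at hc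
  rcases le_total A M with hAM | hAM
  · have h1 : A ^ 2 * M ^ 2 ≤ (2 * S) * M ^ 2 := by
      calc A ^ 2 * M ^ 2 = (A * M) ^ 2 := by ring
        _ ≤ S * (A * M + M ^ 2) := h
        _ ≤ S * (M * M + M ^ 2) := by gcongr
        _ = _ := by ring
    have h2 : A ^ 2 ≤ 2 * S := le_of_mul_le_mul_right h1 (by positivity)
    nlinarith
  · have hA0 : 0 < A := by linarith
    have h1 : (A * M) * (A * M) ≤ (A * M) * (2 * S) := by
      calc (A * M) * (A * M) = (A * M) ^ 2 := by ring
        _ ≤ S * (A * M + M ^ 2) := h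
        _ ≤ S * (A * M + A * M) := by
          have : M ^ 2 ≤ A * M := by nlinarith
          gcongr
        _ = _ := by ring
    have h2 : A * M ≤ 2 * S := le_of_mul_le_mul_left h1 (by positivity)
    nlinarith

/-- difference value -/
def g3 {p : ℕ} (h : ZMod p) (i : ℕ × ℕ × ℕ) : ZMod p := (i.1 : ZMod p) * (h ^ i.2.1 - h ^ i.2.2)

theorem J2_bound {p : ℕ} [Fact p.Prime] (h : ZMod p) (N : ℕ) (hN : N ^ 2 ≤ p)
    (hinj : Set.InjOn (fun y : ℕ => h ^ y) (Set.Iic N)) :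
    ((I3 N N ×ˢ I3 N N).filter (fun q => g3 h q.1 = g3 h q.2)).card ≤
      (PP N).card * N ^ 3 + (PP N).card ^ 2 * N ^ 2 + N ^ 4 := by
  classical
  have hlt := sq_lt_of_prime (Fact.out : p.Prime) hN
  have hNp : N < p := lt_of_le_of_lt (Nat.le_self_pow (by norm_num) N) hlt
  set J := (I3 N N ×ˢ I3 N N).filter (fun q => g3 h q.1 = g3 h q.2) with hJ
  have hmem : ∀ q ∈ J, q.1.1 ∈ PP N ∧ q.1.2.1 ∈ Icc 1 N ∧ q.1.2.2 ∈ Icc 1 N ∧ q.2.1 ∈ PP N ∧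
      q.2.2.1 ∈ Icc 1 N ∧ q.2.2.2 ∈ Icc 1 N ∧
      (q.1.1 : ZMod p) * (h ^ q.1.2.1 - h ^ q.1.2.2) = q.2.1 * (h ^ q.2.2.1 - h ^ q.2.2.2) := by
    intro q hq
    rw [hJ, mem_filter] at hq
    simp only [I3, g3, mem_product] at hq
    tauto
  clear_value J
  have hI : ∀ a b : ℕ, a ∈ Icc 1 N → b ∈ Icc 1 N → h ^ a = h ^ b → a = b := by
    intro a b ha hb e
    rw [mem_Icc] at ha hb
    exact hinj (Set.mem_Iic.2 ha.2) (Set.mem_Iic.2 hb.2) e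
  have hsplit : J ⊆ J.filter (fun q => q.1.1 = q.2.1) ∪
      J.filter (fun q => h ^ q.1.2.1 - h ^ q.1.2.2 = 0) ∪
      J.filter (fun q => q.1.1 ≠ q.2.1 ∧ h ^ q.1.2.1 - h ^ q.1.2.2 ≠ 0) := by
    intro q hq
    simp only [mem_union, mem_filter, hq, true_and]
    tauto
  have h1 : (J.filter (fun q => q.1.1 = q.2.1)).card ≤ (PP N).card * N ^ 3 := by
    have : (PP N).card * N ^ 3 = ((PP N ×ˢ Icc 1 N) ×ˢ (Icc 1 N ×ˢ Icc 1 N)).card := by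
      simp only [card_product, Nat.card_Icc]; simp; ring
    rw [this]
    refine card_le_card_of_injOn (fun q => ((q.1.1, q.1.2.1), (q.1.2.2, q.2.2.1))) ?_ ?_
    · intro q hq
      obtain ⟨hq1, hq2⟩ := mem_filter.1 (mem_coe.1 hq)
      obtain ⟨a1, a2, a3, a4, a5, a6, a7⟩ := hmem q hq1
      simp only [mem_coe, mem_product]
      exact ⟨⟨a1, a2⟩, a3, a5⟩
    · intro q hq r hr hqr
      obtain ⟨hq1, hq2⟩ := mem_filter.1 (mem_coe.1 hq)
      obtain ⟨hr1, hr2⟩ := mem_filter.1 (mem_coe.1 hr)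
      obtain ⟨a1, a2, a3, a4, a5, a6, a7⟩ := hmem q hq1
      obtain ⟨b1, b2, b3, b4, b5, b6, b7⟩ := hmem r hr1
      simp only [Prod.mk.injEq] at hqr
      obtain ⟨⟨e1, e2⟩, e3, e4⟩ := hqr
      rw [← hq2] at a7
      rw [← hr2] at b7
      have a8 := mul_left_cancel₀ (PP_ne hNp a1) a7
      have b8 := mul_left_cancel₀ (PP_ne hNp b1) b7
      rw [← e2, ← e3, ← e4] at b8
      have e5 := hI _ _ a6 b6 (by linear_combination a8 - b8)
      exact Prod.ext (Prod.ext e1 (Prod.ext e2 e3))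
        (Prod.ext (hq2.symm.trans (e1.trans hr2)) (Prod.ext e4 e5))
  have h2 : (J.filter (fun q => h ^ q.1.2.1 - h ^ q.1.2.2 = 0)).card ≤ (PP N).card ^ 2 * N ^ 2 := by
    have : (PP N).card ^ 2 * N ^ 2 = ((PP N ×ˢ PP N) ×ˢ (Icc 1 N ×ˢ Icc 1 N)).card := by
      simp only [card_product, Nat.card_Icc]; simp; ring
    rw [this]
    refine card_le_card_of_injOn (fun q => ((q.1.1, q.2.1), (q.1.2.1, q.2.2.1))) ?_ ?_
    · intro q hq
      obtain ⟨hq1, hq2⟩ := mem_filter.1 (mem_coe.1 hq)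
      obtain ⟨a1, a2, a3, a4, a5, a6, a7⟩ := hmem q hq1
      simp only [mem_coe, mem_product]
      exact ⟨⟨a1, a4⟩, a2, a5⟩
    · intro q hq r hr hqr
      obtain ⟨hq1, hq2⟩ := mem_filter.1 (mem_coe.1 hq)
      obtain ⟨hr1, hr2⟩ := mem_filter.1 (mem_coe.1 hr)
      obtain ⟨a1, a2, a3, a4, a5, a6, a7⟩ := hmem q hq1
      obtain ⟨b1, b2, b3, b4, b5, b6, b7⟩ := hmem r hr1
      rw [hq2, mul_zero] at a7
      rw [hr2, mul_zero] at b7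
      have a8 := (mul_eq_zero.1 a7.symm).resolve_left (PP_ne hNp a4)
      have b8 := (mul_eq_zero.1 b7.symm).resolve_left (PP_ne hNp b4)
      simp only [Prod.mk.injEq] at hqr
      obtain ⟨⟨e1, e2⟩, e3, e4⟩ := hqr
      rw [← e3] at hr2
      rw [← e4] at b8
      exact Prod.ext (Prod.ext e1 (Prod.ext e3 (hI _ _ a3 b3 (by linear_combination hr2 - hq2))))
        (Prod.ext e2 (Prod.ext e4 (hI _ _ a6 b6 (by linear_combination b8 - a8))))
  have h3 : (J.filter (fun q => q.1.1 ≠ q.2.1 ∧ h ^ q.1.2.1 - h ^ q.1.2.2 ≠ 0)).card ≤ N ^ 4 := by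
    have : N ^ 4 = ((Icc 1 N ×ˢ Icc 1 N) ×ˢ (Icc 1 N ×ˢ Icc 1 N)).card := by
      simp only [card_product, Nat.card_Icc]; simp; ring
    rw [this]
    refine card_le_card_of_injOn (fun q => (q.1.2, q.2.2)) ?_ ?_
    · intro q hq
      obtain ⟨hq1, hq2⟩ := mem_filter.1 (mem_coe.1 hq)
      obtain ⟨a1, a2, a3, a4, a5, a6, a7⟩ := hmem q hq1
      simp only [mem_coe, mem_product]
      exact ⟨⟨a2, a3⟩, a5, a6⟩
    · intro q hq r hr hqr
      obtain ⟨hq1, hq2, hq3⟩ := mem_filter.1 (mem_coe.1 hq)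
      obtain ⟨hr1, hr2, hr3⟩ := mem_filter.1 (mem_coe.1 hr)
      obtain ⟨a1, a2, a3, a4, a5, a6, a7⟩ := hmem q hq1
      obtain ⟨b1, b2, b3, b4, b5, b6, b7⟩ := hmem r hr1
      simp only [Prod.mk.injEq] at hqr
      obtain ⟨e1, e2⟩ := hqr
      rw [← e1, ← e2] at b7
      simp only [PP, mem_filter, mem_Icc] at a1 a4 b1 b4
      have hr := prime_ratio (p := p) (a := q.1.1) (b := q.2.1) (a' := r.1.1) (b' := r.2.1)
          (lt_of_le_of_lt (by nlinarith) hlt) (lt_of_le_of_lt (by nlinarith) hlt)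
          a1.2 a4.2 b1.2 hq2 (by
            apply mul_left_cancel₀ hq3
            linear_combination (r.2.1 : ZMod p) * a7 - (q.2.1 : ZMod p) * b7)
      exact Prod.ext (Prod.ext hr.1 e1) (Prod.ext hr.2 e2)
  calc J.card ≤ _ := card_le_card hsplit
    _ ≤ _ := (card_union_le _ _).trans (Nat.add_le_add_right (card_union_le _ _) _)
    _ ≤ _ := by omega


/-- index set of 5-tuples -/
def I5 (N : ℕ) : Finset (ℕ × (ℕ × ℕ) × (ℕ × ℕ)) :=
  PP N ×ˢ ((Icc 1 N ×ˢ Icc 1 N) ×ˢ (Icc 1 N ×ˢ Icc 1 N))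

/-- value of a 5-tuple -/
def f5 {p : ℕ} (h : ZMod p) (q : ℕ × (ℕ × ℕ) × (ℕ × ℕ)) : ZMod p :=
  (q.1 : ZMod p) * (h ^ q.2.1.1 + h ^ q.2.1.2 + h ^ q.2.2.1 + h ^ q.2.2.2)

theorem I5_image {p : ℕ} (h : ZMod p) (N : ℕ) : ((I5 N).image (f5 h)).card ≤ (XX h N).card := by
  refine card_le_card (image_subset_image ?_)
  refine product_subset_product (filter_subset _ _) subset_rfl

theorem f5_sum {p : ℕ} [Fact p.Prime] (h : ZMod p) (N : ℕ) (t : ZMod p) :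
    ∑ i ∈ I5 N, ee (t * f5 h i) = ∑ a ∈ PP N, SS h N (a * t) ^ 4 := by
  rw [I5, sum_product]
  refine sum_congr rfl fun a _ => ?_
  have : SS h N (a * t) ^ 4 = SS h N (a * t) ^ 2 * SS h N (a * t) ^ 2 := by ring
  rw [this, SS_sq, sum_mul_sum, sum_product]
  refine sum_congr rfl fun i _ => sum_congr rfl fun j _ => ?_
  rw [← ee_add]
  congr 1
  simp only [f5]
  ring

theorem g3_sum {p : ℕ} [Fact p.Prime] (h : ZMod p) (N : ℕ) (t : ZMod p) :
    ∑ i ∈ I3 N N, ee (t * g3 h i) = ((∑ a ∈ PP N, ‖SS h N (a * t)‖ ^ 2 : ℝ) : ℂ) := by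
  rw [I3, sum_product, Complex.ofReal_sum]
  refine sum_congr rfl fun a _ => ?_
  have := normsq_sum (Icc 1 N) (fun _ => 1) (fun y => h ^ y) (a * t)
  simp only [one_mul, map_one] at this
  unfold SS
  rw [this, sum_product]
  refine sum_congr rfl fun i _ => sum_congr rfl fun j _ => ?_
  congr 1
  simp only [g3]
  ring

/-- the special multipliers -/
noncomputable def kap {p : ℕ} [Fact p.Prime] (h : ZMod p) (N : ℕ) (s : ℝ) (t : ZMod p) : Finset ℕ :=
  (PP N).filter (fun a => (a : ZMod p) * t ∈ Sp h N s)

theorem kap_sum {p : ℕ} [Fact p.Prime] (h : ZMod p) (N : ℕ) (hN : N < p) (s : ℝ) :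
    ∑ t : ZMod p, (kap h N s t).card = (PP N).card * (Sp h N s).card := by
  classical
  simp only [kap, card_filter]
  rw [sum_comm, card_eq_sum_ones (PP N), sum_mul]
  refine sum_congr rfl fun a ha => ?_
  rw [one_mul, ← card_filter]
  have ha0 := PP_ne hN ha
  refine card_bij (fun t _ => (a : ZMod p) * t) ?_ ?_ ?_
  · intro t ht
    simpa using ht
  · intro t _ t' _ e
    exact mul_left_cancel₀ ha0 e
  · intro b hb
    refine ⟨b / a, ?_, ?_⟩
    · simp only [mem_filter, mem_univ, true_and]
      rwa [mul_div_cancel₀ _ ha0]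
    · rw [mul_div_cancel₀ _ ha0]

theorem pointwise {p : ℕ} [Fact p.Prime] (h : ZMod p) (N : ℕ) (s : ℝ) (hs : 0 ≤ s) (t : ZMod p) :
    ‖∑ a ∈ PP N, SS h N (a * t) ^ 4‖ ≤
      s ^ 2 * N ^ 2 * ∑ a ∈ PP N, ‖SS h N (a * t)‖ ^ 2 + (kap h N s t).card * (N : ℝ) ^ 4 := by
  classical
  have h1 : ∀ a ∈ PP N, ‖SS h N (a * t) ^ 4‖ ≤ s ^ 2 * N ^ 2 * ‖SS h N (a * t)‖ ^ 2 +
      (if (a : ZMod p) * t ∈ Sp h N s then (N : ℝ) ^ 4 else 0) := by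
    intro a _
    rw [norm_pow]
    split_ifs with hm
    · have := SS_norm_le h N (a * t)
      have : ‖SS h N (a * t)‖ ^ 4 ≤ (N : ℝ) ^ 4 := by gcongr
      have : 0 ≤ s ^ 2 * N ^ 2 * ‖SS h N (a * t)‖ ^ 2 := by positivity
      linarith
    · rw [mem_Sp, not_le] at hm
      have : ‖SS h N (a * t)‖ ^ 2 ≤ (s * N) ^ 2 := by gcongr
      calc ‖SS h N (a * t)‖ ^ 4 = ‖SS h N (a * t)‖ ^ 2 * ‖SS h N (a * t)‖ ^ 2 := by ring
        _ ≤ (s * N) ^ 2 * ‖SS h N (a * t)‖ ^ 2 := by gcongr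
        _ = _ := by ring
  refine (norm_sum_le _ _).trans ((sum_le_sum h1).trans (le_of_eq ?_))
  rw [sum_add_distrib, mul_sum, ← sum_filter, sum_const, nsmul_eq_mul, kap]

theorem J4_bound {p : ℕ} [Fact p.Prime] (h : ZMod p) (N : ℕ) (hN : N < p) (s κ : ℝ) (hs : 0 ≤ s)
    (hκ : ∀ t : ZMod p, t ≠ 0 → ((kap h N s t).card : ℝ) ≤ κ) (hκ0 : 0 ≤ κ) :
    p * (((I5 N ×ˢ I5 N).filter (fun q => f5 h q.1 = f5 h q.2)).card : ℝ) ≤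
      ((PP N).card * (N : ℝ) ^ 4) ^ 2 +
      2 * s ^ 4 * N ^ 4 * (p * (((I3 N N ×ˢ I3 N N).filter (fun q => g3 h q.1 = g3 h q.2)).card : ℝ)) +
      2 * N ^ 8 * (κ * ((PP N).card * (Sp h N s).card)) := by
  classical
  rw [← orth (I5 N) (f5 h), ← orth (I3 N N) (g3 h)]
  simp only [f5_sum, g3_sum]
  have hD : ∀ t : ZMod p, ‖((∑ a ∈ PP N, ‖SS h N (a * t)‖ ^ 2 : ℝ) : ℂ)‖ ^ 2 =
      (∑ a ∈ PP N, ‖SS h N (a * t)‖ ^ 2) ^ 2 := by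
    intro t
    rw [Complex.norm_real, Real.norm_eq_abs, sq_abs]
  simp only [hD]
  have hpt : ∀ t : ZMod p, ‖∑ a ∈ PP N, SS h N (a * t) ^ 4‖ ^ 2 ≤
      (if t = 0 then ((PP N).card * (N : ℝ) ^ 4) ^ 2 else 0) +
      2 * s ^ 4 * N ^ 4 * (∑ a ∈ PP N, ‖SS h N (a * t)‖ ^ 2) ^ 2 +
      2 * N ^ 8 * (κ * (kap h N s t).card) := by
    intro t
    have p1 : 0 ≤ 2 * s ^ 4 * N ^ 4 * (∑ a ∈ PP N, ‖SS h N (a * t)‖ ^ 2) ^ 2 := by positivity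
    have p2 : 0 ≤ 2 * N ^ 8 * (κ * (kap h N s t).card) := by positivity
    split_ifs with ht
    · have : ‖∑ a ∈ PP N, SS h N (a * t) ^ 4‖ ≤ (PP N).card * (N : ℝ) ^ 4 := by
        refine (norm_sum_le _ _).trans ?_
        rw [← nsmul_eq_mul, ← sum_const]
        refine sum_le_sum fun a _ => ?_
        rw [norm_pow]
        have := SS_norm_le h N (a * t)
        gcongr
      have : ‖∑ a ∈ PP N, SS h N (a * t) ^ 4‖ ^ 2 ≤ ((PP N).card * (N : ℝ) ^ 4) ^ 2 := by gcongr
      linarith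
    · have h1 := pointwise h N s hs t
      have h2 := hκ t ht
      set D := ∑ a ∈ PP N, ‖SS h N (a * t)‖ ^ 2
      set c : ℝ := ((kap h N s t).card : ℝ)
      have hc : 0 ≤ c := Nat.cast_nonneg _
      calc ‖∑ a ∈ PP N, SS h N (a * t) ^ 4‖ ^ 2 ≤ (s ^ 2 * N ^ 2 * D + c * (N : ℝ) ^ 4) ^ 2 := by gcongr
        _ ≤ 2 * (s ^ 2 * N ^ 2 * D) ^ 2 + 2 * (c * (N : ℝ) ^ 4) ^ 2 := by
          nlinarith [sq_nonneg (s ^ 2 * N ^ 2 * D - c * (N : ℝ) ^ 4)]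
        _ = 0 + 2 * s ^ 4 * N ^ 4 * D ^ 2 + 2 * N ^ 8 * (c * c) := by ring
        _ ≤ _ := by gcongr
  refine (sum_le_sum fun t _ => hpt t).trans (le_of_eq ?_)
  rw [sum_add_distrib, sum_add_distrib, ← mul_sum, ← mul_sum, ← mul_sum, sum_ite_eq' univ]
  have := kap_sum h N hN s
  have e : (∑ t : ZMod p, ((kap h N s t).card : ℝ)) = (PP N).card * (Sp h N s).card := by
    exact_mod_cast this
  rw [e]
  simp


theorem PP_card_le (N : ℕ) : (PP N).card ≤ N := by
  refine (card_filter_le _ _).trans ?_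
  simp

theorem kap_bound {p : ℕ} [Fact p.Prime] (h : ZMod p) (hh : h ≠ 0) (N : ℕ) (hN2 : 2 ≤ N)
    (hN : N ^ 2 ≤ p)
    (hinj : Set.InjOn (fun y : ℕ => h ^ y) (Set.Iic N)) (θ κ : ℝ) (hθ : 0 < θ) (hθ1 : θ ≤ 1)
    (hκ : 0 ≤ κ) (hκ1 : 2 * κ ≤ θ * N) (hS : 2 * ((Sp h N θ).card : ℝ) < κ ^ 2)
    (t : ZMod p) (ht : t ≠ 0) : ((kap h N (2 * θ) t).card : ℝ) ≤ κ := by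
  have hN2R : (2 : ℝ) ≤ N := by exact_mod_cast hN2
  set M := ⌊θ * N / 2⌋₊ + 1 with hM
  have hfl : (⌊θ * N / 2⌋₊ : ℝ) ≤ θ * N / 2 := Nat.floor_le (by positivity)
  have hfl2 : θ * N / 2 < (⌊θ * N / 2⌋₊ : ℝ) + 1 := Nat.lt_floor_add_one _
  have hMN : M ≤ N := by
    have : (M : ℝ) ≤ N := by
      rw [hM]; push_cast
      nlinarith
    exact_mod_cast this
  have key := kappa_aux h hh N M hN hMN hinj t ht (kap h N (2 * θ) t) (filter_subset _ _)
    (Sp h N θ) (by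
      intro a ha j hj
      have ha2 := (mem_filter.1 ha).2
      rw [mem_Sp] at ha2 ⊢
      have := SS_shift h N (a * t) j
      have hj2 : (j : ℝ) ≤ (⌊θ * N / 2⌋₊ : ℝ) := by
        exact_mod_cast (by omega : j ≤ ⌊θ * N / 2⌋₊)
      nlinarith)
  refine kappa_bound (Nat.cast_nonneg _) ?_ (Nat.cast_nonneg _) key κ hκ ?_ hS
  · rw [hM]; positivity
  · rw [hM]; push_cast; linarith

set_option maxHeartbeats 1000000 in
theorem regB (δ : ℝ) (hδ0 : 0 < δ) (hδ1 : δ ≤ 1 / 40) : ∃ N1 : ℕ, ∀ (p : ℕ) [Fact p.Prime]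
    (h : ZMod p) (N : ℕ), h ≠ 0 → N1 ≤ N → (N : ℝ) ^ 2 ≤ p →
    Set.InjOn (fun y : ℕ => h ^ y) (Set.Iic N) →
    p ≤ (⌊(N : ℝ) ^ (1 - δ)⌋₊) ^ 4 → (N : ℝ) ^ 2 ≤ 99 * (XX h N).card := by
  obtain ⟨ε, hεδ⟩ : ∃ ε, ε = δ / 2 := ⟨_, rfl⟩
  have hε0 : 0 < ε := by rw [hεδ]; positivity
  have hε1 : ε ≤ 1 / 80 := by linarith
  obtain ⟨η', hη', M0, hstar⟩ := star ε hε0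
  obtain ⟨η, hηd⟩ : ∃ η, η = min η' ε := ⟨_, rfl⟩
  have hη0 : 0 < η := by rw [hηd]; positivity
  have hη1 : η ≤ η' := hηd ▸ min_le_left _ _
  have hη2 : η ≤ ε := hηd ▸ min_le_right _ _
  obtain ⟨M1, hM1⟩ := prime_count (2 * η) (by positivity)
  obtain ⟨M2, hM2⟩ := pow_large ε hε0 3
  refine ⟨max (max M0 M1) (max M2 2), ?_⟩
  intro p _ h N hh hN hNp hinj hKp
  have hst := hstar p h N hh (by omega) hNp hinj
  have hk1 := hM1 N (by omega)
  have b2 := hM2 N (by omega)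
  have hN2 : 2 ≤ N := by omega
  have hNR : (2 : ℝ) ≤ N := by exact_mod_cast hN2
  have hN1 : (1 : ℝ) ≤ N := by linarith
  have hN0 : (0 : ℝ) < N := by linarith
  have hNpn : N ^ 2 ≤ p := by exact_mod_cast hNp
  have hNltp : N < p := lt_of_lt_of_le (by nlinarith) hNpn
  have hp0 : (0 : ℝ) < p := by exact_mod_cast (Fact.out : p.Prime).pos
  have hpN : (p : ℝ) ≤ (N : ℝ) ^ (4 - 8 * ε) := by
    calc (p : ℝ) ≤ (⌊(N : ℝ) ^ (1 - δ)⌋₊ : ℝ) ^ 4 := by exact_mod_cast hKp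
      _ ≤ ((N : ℝ) ^ (1 - δ)) ^ 4 := by
        gcongr
        exact Nat.floor_le (by positivity)
      _ = (N : ℝ) ^ ((1 - δ) * (4 : ℕ)) := by rw [Real.rpow_mul_natCast hN0.le]
      _ = _ := by congr 1; push_cast; rw [hεδ]; ring
  obtain ⟨θ, hθ⟩ : ∃ θ, θ = (N : ℝ) ^ (-η) := ⟨_, rfl⟩
  have hθ0 : 0 < θ := by rw [hθ]; positivity
  have hθ1 : θ ≤ 1 := by rw [hθ]; exact Real.rpow_le_one_of_one_le_of_nonpos hN1 (by linarith)
  obtain ⟨κ, hκ⟩ : ∃ κ, κ = (N : ℝ) ^ (1 - 3 * ε) := ⟨_, rfl⟩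
  have hκ0 : 0 ≤ κ := by rw [hκ]; positivity
  have hSc : ((Sp h N θ).card : ℝ) ≤ p * (N : ℝ) ^ (ε - 2) := by
    refine le_trans ?_ hst
    have : Sp h N θ ⊆ Sp h N ((N : ℝ) ^ (-η')) := Sp_mono h N (by
      rw [hθ]; exact Real.rpow_le_rpow_of_exponent_le hN1 (by linarith))
    exact_mod_cast card_le_card this
  have hSc2 : ((Sp h N (2 * θ)).card : ℝ) ≤ p * (N : ℝ) ^ (ε - 2) := by
    refine le_trans ?_ hSc
    exact_mod_cast card_le_card (Sp_mono h N (by linarith : θ ≤ 2 * θ))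
  have hκ1 : 2 * κ ≤ θ * N := by
    have e1 : θ * N = (N : ℝ) ^ (1 - η) := by
      nth_rewrite 1 [← Real.rpow_one (N : ℝ)]
      rw [hθ, ← Real.rpow_add hN0]; congr 1; ring
    rw [e1]
    calc 2 * κ ≤ (N : ℝ) ^ ε * (N : ℝ) ^ (1 - 3 * ε) := by rw [hκ]; gcongr; linarith
      _ = (N : ℝ) ^ (1 - 2 * ε) := by rw [← Real.rpow_add hN0]; congr 1; ring
      _ ≤ _ := Real.rpow_le_rpow_of_exponent_le hN1 (by linarith)
  have hSκ : 2 * ((Sp h N θ).card : ℝ) < κ ^ 2 := by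
    have e1 : κ ^ 2 = (N : ℝ) ^ ε * (N : ℝ) ^ (2 - 7 * ε) := by
      rw [hκ, ← Real.rpow_mul_natCast hN0.le, ← Real.rpow_add hN0]; congr 1; push_cast; ring
    have e2 : ((Sp h N θ).card : ℝ) ≤ (N : ℝ) ^ (2 - 7 * ε) := by
      calc ((Sp h N θ).card : ℝ) ≤ (N : ℝ) ^ (4 - 8 * ε) * (N : ℝ) ^ (ε - 2) :=
            hSc.trans (by gcongr)
        _ = _ := by rw [← Real.rpow_add hN0]; congr 1; ring
    have e3 : 0 < (N : ℝ) ^ (2 - 7 * ε) := by positivity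
    rw [e1]
    nlinarith
  have hJ := J4_bound h N hNltp (2 * θ) κ (by positivity)
    (fun t ht => kap_bound h hh N hN2 hNpn hinj θ κ hθ0 hθ1 hκ0 hκ1 hSκ t ht) hκ0
  have hJ2 := J2_bound h N hNpn hinj
  have hkN := PP_card_le N
  have hcs := cs_fiber (I5 N) (f5 h)
  have him := I5_image h N
  have hI : ((I5 N).card : ℝ) = (PP N).card * (N : ℝ) ^ 4 := by
    rw [I5, card_product, card_product, card_product, Nat.card_Icc, Nat.add_sub_cancel]
    push_cast
    ring
  rw [hI] at hcs
  have himR : (((I5 N).image (f5 h)).card : ℝ) ≤ (XX h N).card := by exact_mod_cast him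
  have hJ2R : (((I3 N N ×ˢ I3 N N).filter (fun q => g3 h q.1 = g3 h q.2)).card : ℝ) ≤ 3 * N ^ 4 := by
    have : ((I3 N N ×ˢ I3 N N).filter (fun q => g3 h q.1 = g3 h q.2)).card ≤ 3 * N ^ 4 := by
      refine hJ2.trans ?_
      calc _ ≤ N * N ^ 3 + N ^ 2 * N ^ 2 + N ^ 4 := by gcongr
        _ = _ := by ring
    exact_mod_cast this
  generalize ((I5 N ×ˢ I5 N).filter (fun q => f5 h q.1 = f5 h q.2)).card = J4 at hJ hcs
  generalize ((I3 N N ×ˢ I3 N N).filter (fun q => g3 h q.1 = g3 h q.2)).card = J2 at hJ hJ2R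
  generalize ((I5 N).image (f5 h)).card = im at hcs himR
  generalize (XX h N).card = X at himR ⊢
  generalize (Sp h N (2 * θ)).card = S2 at hJ hSc2
  obtain ⟨k, hk⟩ : ∃ k : ℝ, k = ((PP N).card : ℝ) := ⟨_, rfl⟩
  rw [← hk] at hJ hcs hk1
  have hkpos : 0 < k := lt_of_lt_of_le (by positivity) hk1
  have t1 : (k * (N : ℝ) ^ 4) ^ 2 ≤ p * (k ^ 2 * N ^ 6) := by
    calc (k * (N : ℝ) ^ 4) ^ 2 = (N : ℝ) ^ 2 * (k ^ 2 * N ^ 6) := by ring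
      _ ≤ _ := by gcongr
  have t2 : 2 * (2 * θ) ^ 4 * N ^ 4 * (p * (J2 : ℝ)) ≤ p * (96 * (k ^ 2 * N ^ 6)) := by
    have e1 : θ ^ 4 * (N : ℝ) ^ 2 = ((N : ℝ) ^ (1 - 2 * η)) ^ 2 := by
      rw [hθ, ← Real.rpow_mul_natCast hN0.le, ← Real.rpow_mul_natCast hN0.le]
      rw [← Real.rpow_natCast (N : ℝ) 2, ← Real.rpow_add hN0]; congr 1; push_cast; ring
    calc 2 * (2 * θ) ^ 4 * N ^ 4 * (p * (J2 : ℝ)) ≤ 2 * (2 * θ) ^ 4 * N ^ 4 * (p * (3 * N ^ 4)) := by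
          gcongr
      _ = p * (96 * ((θ ^ 4 * (N : ℝ) ^ 2) * N ^ 6)) := by ring
      _ = p * (96 * (((N : ℝ) ^ (1 - 2 * η)) ^ 2 * N ^ 6)) := by rw [e1]
      _ ≤ _ := by gcongr
  have t3 : 2 * (N : ℝ) ^ 8 * (κ * (k * S2)) ≤ p * (2 * (k ^ 2 * N ^ 6)) := by
    have e1 : (N : ℝ) ^ 2 * κ * (N : ℝ) ^ (ε - 2) = (N : ℝ) ^ (1 - 2 * ε) := by
      rw [hκ, ← Real.rpow_natCast (N : ℝ) 2, ← Real.rpow_add hN0, ← Real.rpow_add hN0]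
      congr 1; push_cast; ring
    have e2 : (N : ℝ) ^ (1 - 2 * ε) ≤ k :=
      (Real.rpow_le_rpow_of_exponent_le hN1 (by linarith)).trans hk1
    calc 2 * (N : ℝ) ^ 8 * (κ * (k * S2)) ≤ 2 * (N : ℝ) ^ 8 * (κ * (k * (p * (N : ℝ) ^ (ε - 2)))) := by
          gcongr
      _ = p * (2 * (k * ((N : ℝ) ^ 2 * κ * (N : ℝ) ^ (ε - 2)) * N ^ 6)) := by ring
      _ = p * (2 * (k * (N : ℝ) ^ (1 - 2 * ε) * N ^ 6)) := by rw [e1]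
      _ ≤ p * (2 * (k * k * N ^ 6)) := by gcongr
      _ = _ := by ring
  have hJ99 : (J4 : ℝ) ≤ 99 * (k ^ 2 * N ^ 6) := by
    refine le_of_mul_le_mul_left ?_ hp0
    calc (p : ℝ) * J4 ≤ _ := hJ
      _ ≤ p * (k ^ 2 * N ^ 6) + p * (96 * (k ^ 2 * N ^ 6)) + p * (2 * (k ^ 2 * N ^ 6)) := by
        linarith
      _ = _ := by ring
  have hfin : (k ^ 2 * N ^ 6) * (N : ℝ) ^ 2 ≤ (k ^ 2 * N ^ 6) * (99 * X) := by
    calc (k ^ 2 * N ^ 6) * (N : ℝ) ^ 2 = (k * N ^ 4) ^ 2 := by ring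
      _ ≤ _ := hcs
      _ ≤ X * (99 * (k ^ 2 * N ^ 6)) := by gcongr
      _ = _ := by ring
  exact le_of_mul_le_mul_left hfin (by positivity)


theorem stmt_4 :
    ∃ c : ℝ, 0 < c ∧ ∀ (p : ℕ), p.Prime → 2 < p →
      ∀ h : (ZMod p)ˣ, (∀ u : (ZMod p)ˣ, u ∈ Subgroup.zpowers h) →
      ∀ N : ℕ, 1 ≤ N → (N : ℝ) ≤ (p : ℝ) ^ ((1 : ℝ) / 2) →
      c * (N : ℝ) ^ 2 ≤
        ((((Finset.Icc 1 N ×ˢ ((Finset.Icc 1 N ×ˢ Finset.Icc 1 N) ×ˢ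
            (Finset.Icc 1 N ×ˢ Finset.Icc 1 N)))).image
          (fun q => (q.1 : ZMod p) *
            ((h : ZMod p) ^ q.2.1.1 + (h : ZMod p) ^ q.2.1.2 +
             (h : ZMod p) ^ q.2.2.1 + (h : ZMod p) ^ q.2.2.2))).card : ℝ) := by
  obtain ⟨δ, hδ0, hδ1, N0, hT⟩ := T2_bound
  obtain ⟨N1, hA⟩ := regA δ hδ0 hδ1
  obtain ⟨N2, hB⟩ := regB δ hδ0 hδ1
  obtain ⟨L, hL⟩ : ∃ L, L = max (max N0 N1) (max N2 3) := ⟨_, rfl⟩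
  have hL3 : 3 ≤ L := by omega
  have hL0 : (0 : ℝ) < L := by exact_mod_cast (by omega : 0 < L)
  refine ⟨min (1 / 99) (1 / (L : ℝ) ^ 2), by positivity, ?_⟩
  intro p hp hp2 h hgen N hN hNp
  have : Fact p.Prime := ⟨hp⟩
  change _ ≤ ((XX (h : ZMod p) N).card : ℝ)
  have hNR : (1 : ℝ) ≤ N := by exact_mod_cast hN
  have hp0 : (0 : ℝ) ≤ p := Nat.cast_nonneg _
  have hsq : (N : ℝ) ^ 2 ≤ p := by
    calc (N : ℝ) ^ 2 ≤ ((p : ℝ) ^ ((1 : ℝ) / 2)) ^ 2 := by gcongr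
      _ = (p : ℝ) := by rw [← Real.sqrt_eq_rpow, Real.sq_sqrt hp0]
  rcases lt_or_ge N L with hlt | hge
  · have hne : 0 < (XX (h : ZMod p) N).card := by
      rw [card_pos, XX, image_nonempty]
      have : (Icc 1 N).Nonempty := ⟨1, by simp [hN]⟩
      exact this.product ((this.product this).product (this.product this))
    have hne' : (1 : ℝ) ≤ (XX (h : ZMod p) N).card := by exact_mod_cast hne
    have hNL : (N : ℝ) ≤ L := by exact_mod_cast hlt.le
    calc _ ≤ 1 / (L : ℝ) ^ 2 * (L : ℝ) ^ 2 := by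
          gcongr
          exact min_le_right _ _
      _ = 1 := by field_simp
      _ ≤ _ := hne'
  · have hh : (h : ZMod p) ≠ 0 := h.ne_zero
    have hsqn : N ^ 2 ≤ p := by exact_mod_cast hsq
    have hord : orderOf h = p - 1 := by
      rw [orderOf_eq_card_of_forall_mem_zpowers hgen, Nat.card_eq_fintype_card, ZMod.card_units]
    have hNo : N < p - 1 := by
      have : N * 3 ≤ N ^ 2 := by nlinarith
      omega
    have hinj : Set.InjOn (fun y : ℕ => (h : ZMod p) ^ y) (Set.Iic N) := by
      intro a ha b hb hab
      rw [Set.mem_Iic] at ha hb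
      have e : h ^ a = h ^ b := by
        ext
        push_cast
        exact hab
      exact pow_injOn_Iio_orderOf (by rw [Set.mem_Iio, hord]; omega)
        (by rw [Set.mem_Iio, hord]; omega) e
    have hfin : (N : ℝ) ^ 2 ≤ 99 * (XX (h : ZMod p) N).card := by
      rcases lt_or_ge ((⌊(N : ℝ) ^ (1 - δ)⌋₊) ^ 4) p with hK | hK
      · have := hA p h N hp2 hh (by omega) hsq hinj (hT p h N hh (by omega) hsq hinj) hK
        have h0 : (0 : ℝ) ≤ (XX (h : ZMod p) N).card := Nat.cast_nonneg _
        linarith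
      · exact hB p h N hh (by omega) hsq hinj hK
    calc _ ≤ 1 / 99 * (N : ℝ) ^ 2 := by
          gcongr
          exact min_le_left _ _
      _ ≤ _ := by linarith
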